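/- Let f ∈ ℂ[x₀,…,x_n] be a reduced homogeneous polynomial with deg(f) = d > 2 and n > 2, such that the associated projective hypersurface V(f) has only isolated singularities, all of which are weighted homogeneous. Then d(f) ≠ 1. -/

import Mathlib

open MvPolynomial CategoryTheory
open scoped BigOperators unitInterval

noncomputable section

/-! ### Projective space, hypersurfaces and the degree of the gradient map -/

/-- `ℙⁿ(ℂ)`, realized as the projectivization of `ℂ^{n+1}`. -/
abbrev Proj (n : ℕ) := Projectivization ℂ (Fin (n + 1) → ℂ)

instance (n : ℕ) : TopologicalSpace (Proj n) :=
  inferInstanceAs (TopologicalSpace (Quotient _))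

variable {n : ℕ}

/-- The projective zero set `V(f)` of a homogeneous polynomial `f`. -/
def projZeros (f : MvPolynomial (Fin (n + 1)) ℂ) : Set (Proj n) :=
  {x | eval x.rep f = 0}

/-- The principal open set `D(f) = {x ∈ ℙⁿ : f(x) ≠ 0}`. -/
def principalOpen (f : MvPolynomial (Fin (n + 1)) ℂ) : Set (Proj n) :=
  {x | eval x.rep f ≠ 0}

/-- The gradient vector `(f₀(x), …, f_n(x))` of `f` at (a representative of) `x`. -/
def gradVec (f : MvPolynomial (Fin (n + 1)) ℂ) (x : Proj n) : Fin (n + 1) → ℂ :=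
  fun i => eval x.rep (pderiv i f)

/-- The singular locus of the projective hypersurface `V(f)`. -/
def singularLocus (f : MvPolynomial (Fin (n + 1)) ℂ) : Set (Proj n) :=
  {x | eval x.rep f = 0 ∧ ∀ i, eval x.rep (pderiv i f) = 0}

/-- Zariski-closed subsets of `ℙⁿ`: common zero sets of families of homogeneous
polynomials. -/
def IsZariskiClosed (S : Set (Proj n)) : Prop :=
  ∃ T : Set (MvPolynomial (Fin (n + 1)) ℂ),
    (∀ g ∈ T, ∃ m, g.IsHomogeneous m) ∧ S = {x | ∀ g ∈ T, eval x.rep g = 0}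

/-- `U` is a Zariski open and dense subset of `ℙⁿ` (dense: it meets every nonempty
Zariski open set). -/
def IsZariskiOpenDense (U : Set (Proj n)) : Prop :=
  IsZariskiClosed Uᶜ ∧
    ∀ W : Set (Proj n), IsZariskiClosed Wᶜ → W.Nonempty → (U ∩ W).Nonempty

/-- The fiber over `u` of the gradient map `φ_f = grad f : D(f) → ℙⁿ`. -/
def gradFiber (f : MvPolynomial (Fin (n + 1)) ℂ) (u : Proj n) : Set (Proj n) :=
  {x | x ∈ principalOpen f ∧
       ∃ h : gradVec f x ≠ 0, Projectivization.mk ℂ (gradVec f x) h = u}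

/-- `d(f) = k`: there is a Zariski open and dense subset `U ⊆ ℙⁿ` over which every
fiber of the gradient map has exactly `k` points.  (If the gradient map is not
dominant this holds precisely for `k = 0`, taking for `U` the complement of the
closure of the image, so this single definition covers both cases.) -/
def HasGradDegree (f : MvPolynomial (Fin (n + 1)) ℂ) (k : ℕ) : Prop :=
  ∃ U : Set (Proj n), IsZariskiOpenDense U ∧
    ∀ u ∈ U, (gradFiber f u).Finite ∧ (gradFiber f u).ncard = k

/-- The hyperplane of `ℙⁿ` with coefficient vector `c`. -/
def hyperplane (c : Fin (n + 1) → ℂ) : Set (Proj n) :=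
  {x | ∑ i, c i * x.rep i = 0}

/-! ### Affine charts and dehomogenization -/

/-- The affine chart of `ℙⁿ` obtained by setting the `i`-th coordinate to `1`. -/
def affineChart {n : ℕ} (i : Fin (n + 1)) (y : Fin n → ℂ) : Proj n :=
  Projectivization.mk ℂ (i.insertNth 1 y) (by
    intro h
    have := congrFun h i
    simp at this)

/-- Dehomogenization of `f` with respect to the `i`-th coordinate
(the local equation of `V(f)` in the `i`-th affine chart). -/
def dehom {n : ℕ} (f : MvPolynomial (Fin (n + 1)) ℂ) (i : Fin (n + 1)) :
    MvPolynomial (Fin n) ℂ :=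
  aeval (i.insertNth 1 X) f

/-! ### Weighted homogeneous singularities -/

/-- `g` is a weighted homogeneous polynomial for the positive rational weights
`w` (normalized to weighted degree `1`). -/
def IsWeightedHomogeneousPoly {m : ℕ} (g : MvPolynomial (Fin m) ℂ) (w : Fin m → ℚ) : Prop :=
  (∀ i, 0 < w i) ∧ ∀ α ∈ g.support, ∑ i, w i * (α i : ℚ) = 1

/-- The germ at `y₀` of the set `S ⊆ ℂᵐ` is, in suitable local analytic
coordinates, defined by a weighted homogeneous polynomial: there is a local
bianalytic change of coordinates `φ` sending `y₀` to `0` and `S` to the zero set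
of a weighted homogeneous polynomial `g`. -/
def HasWeightedHomogeneousSingularityAt {m : ℕ} (S : Set (Fin m → ℂ))
    (y₀ : Fin m → ℂ) : Prop :=
  ∃ (g : MvPolynomial (Fin m) ℂ) (w : Fin m → ℚ), IsWeightedHomogeneousPoly g w ∧
    ∃ (U W : Set (Fin m → ℂ)) (φ ψ : (Fin m → ℂ) → (Fin m → ℂ)),
      IsOpen U ∧ IsOpen W ∧ y₀ ∈ U ∧ (0 : Fin m → ℂ) ∈ W ∧
      AnalyticOnNhd ℂ φ U ∧ AnalyticOnNhd ℂ ψ W ∧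
      Set.MapsTo φ U W ∧ Set.MapsTo ψ W U ∧
      (∀ y ∈ U, ψ (φ y) = y) ∧ (∀ z ∈ W, φ (ψ z) = z) ∧ φ y₀ = 0 ∧
      ∀ y ∈ U, (y ∈ S ↔ eval (φ y) g = 0)

section Graded

variable {ι τ 𝕜 : Type*} [CommRing 𝕜]

attribute [local instance] MvPolynomial.gradedAlgebra

lemma homogeneousComponent_mul_right {p q : MvPolynomial τ 𝕜} {e : ℕ} (hq : q.IsHomogeneous e)
    (m : ℕ) : homogeneousComponent (m + e) (p * q) = homogeneousComponent m p * q := by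
  simp only [← decomposition.decompose'_apply]
  exact DirectSum.coe_decompose_mul_add_of_right_mem (homogeneousSubmodule τ 𝕜) hq

lemma homogeneousComponent_mul_right_of_lt {p q : MvPolynomial τ 𝕜} {e m : ℕ}
    (hq : q.IsHomogeneous e) (hm : m < e) : homogeneousComponent m (p * q) = 0 := by
  simp only [← decomposition.decompose'_apply]
  exact DirectSum.coe_decompose_mul_of_right_mem_of_not_le (homogeneousSubmodule τ 𝕜) hq
    (not_le.2 hm)

lemma homogeneousComponent_mem_span {S : Set (MvPolynomial τ 𝕜)}
    (hS : ∀ g ∈ S, ∃ m, g.IsHomogeneous m) {p : MvPolynomial τ 𝕜} (hp : p ∈ Ideal.span S)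
    (m : ℕ) : homogeneousComponent m p ∈ Ideal.span S :=
  homogeneousComponent_mem_of_mem (Ideal.homogeneous_span _ _ fun g hg => hS g hg) hp m

lemma mem_of_forall_homogeneousComponent_mem {J : Ideal (MvPolynomial τ 𝕜)}
    {p : MvPolynomial τ 𝕜} (h : ∀ m, homogeneousComponent m p ∈ J) : p ∈ J := by
  rw [← sum_homogeneousComponent p]
  exact J.sum_mem fun m _ => h m

/-- Every member of the family is a nonzerodivisor modulo any set of other members. -/
def IsRegularFamily {A : Type*} [CommRing A] (G : ι → A) : Prop :=
  ∀ (s : Set ι), ∀ k ∉ s, ∀ p, G k * p ∈ Ideal.span (G '' s) → p ∈ Ideal.span (G '' s)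

lemma IsRegularFamily.exists_eq_mul_add {A : Type*} [CommRing A] {G : ι → A} {s : Set ι} {j : ι}
    {y : A} (hy : y ∈ Ideal.span (G '' insert j s)) :
    ∃ z, y - G j * z ∈ Ideal.span (G '' s) := by
  rw [Set.image_insert_eq, Ideal.mem_span_insert] at hy
  obtain ⟨a, z, hz, rfl⟩ := hy
  exact ⟨a, by simpa [mul_comm] using hz⟩

/-- In a homogeneous regular family, a nonzerodivisor modulo all other members
is a nonzerodivisor modulo any subset of them. -/
lemma IsRegularFamily.mem_span_of_mul_mem [Finite ι] {G : ι → MvPolynomial τ 𝕜} {e : ι → ℕ}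
    (hG : IsRegularFamily G) (he : ∀ j, (G j).IsHomogeneous (e j)) (hpos : ∀ j, 0 < e j)
    {k : ι} {b : MvPolynomial τ 𝕜}
    (hb : ∀ p, b * p ∈ Ideal.span (G '' {k}ᶜ) → p ∈ Ideal.span (G '' {k}ᶜ))
    (s : Set ι) (hs : k ∉ s) (p : MvPolynomial τ 𝕜) (hp : b * p ∈ Ideal.span (G '' s)) :
    p ∈ Ideal.span (G '' s) := by
  have hfin : ((insert k s)ᶜ).Finite := Set.toFinite _
  obtain ⟨m, hm⟩ : ∃ m, m = ((insert k s)ᶜ).ncard := ⟨_, rfl⟩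
  induction m using Nat.strong_induction_on generalizing s p with
  | _ m ih =>
  by_cases hS : s = {k}ᶜ
  · subst hS; exact hb p hp
  obtain ⟨j, hjs, hjk⟩ : ∃ j, j ∉ s ∧ j ≠ k := by
    by_contra! H
    refine hS (Set.Subset.antisymm (fun x hx hxk => hs (hxk ▸ hx)) fun x hx => ?_)
    by_contra hxs
    exact hx (H x hxs)
  have hlt : ((insert k (insert j s))ᶜ).ncard < m := by
    rw [hm]
    refine Set.ncard_lt_ncard ?_ hfin
    rw [Set.ssubset_iff_of_subset]
    · exact ⟨j, by simp [hjs, hjk], by simp⟩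
    · exact Set.compl_subset_compl.2 (Set.insert_subset_insert (Set.subset_insert _ _))
  have hIns := ih _ hlt (insert j s) (by simp [hs, hjk.symm])
  have step : ∀ M : ℕ, ∃ y, p - G j ^ M * y ∈ Ideal.span (G '' s) ∧
      b * y ∈ Ideal.span (G '' s) := by
    intro M
    induction M with
    | zero => exact ⟨p, by simp, hp⟩
    | succ M ihM =>
      obtain ⟨y, hy1, hy2⟩ := ihM
      have h1 := hIns y (Ideal.span_mono (Set.image_mono (Set.subset_insert _ _)) hy2)
        (Set.toFinite _) rfl
      obtain ⟨z, hz⟩ := IsRegularFamily.exists_eq_mul_add h1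
      refine ⟨z, ?_, hG s j hjs _ ?_⟩
      · have : p - G j ^ (M + 1) * z = (p - G j ^ M * y) + G j ^ M * (y - G j * z) := by ring
        rw [this]
        exact add_mem hy1 (Ideal.mul_mem_left _ _ hz)
      · have : G j * (b * z) = b * y - b * (y - G j * z) := by ring
        rw [this]
        exact sub_mem hy2 (Ideal.mul_mem_left _ _ hz)
  refine mem_of_forall_homogeneousComponent_mem fun i => ?_
  obtain ⟨y, hy, -⟩ := step (i + 1)
  have h0 : homogeneousComponent i (G j ^ (i + 1) * y) = 0 := by
    rw [mul_comm]
    refine homogeneousComponent_mul_right_of_lt ((he j).pow (i + 1)) ?_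
    have := hpos j
    nlinarith
  have := homogeneousComponent_mem_span (S := G '' s)
    (by rintro _ ⟨l, -, rfl⟩; exact ⟨_, he l⟩) hy i
  rwa [map_sub, h0, sub_zero] at this

/-- Exchange of one member of a homogeneous regular family. -/
lemma IsRegularFamily.exchange [Finite ι] {G G' : ι → MvPolynomial τ 𝕜} {e : ι → ℕ}
    (hG : IsRegularFamily G) (he : ∀ j, (G j).IsHomogeneous (e j)) (hpos : ∀ j, 0 < e j)
    {k : ι} (hGG' : ∀ j ≠ k, G' j = G j) {M : ℕ}
    (hM : G k ^ M ∈ Ideal.span (Set.range G')) :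
    IsRegularFamily G' := by
  have himg : ∀ s : Set ι, k ∉ s → G' '' s = G '' s := fun s hs =>
    Set.image_congr fun j hj => hGG' j fun h => hs (h ▸ hj)
  have hk : k ∉ ({k}ᶜ : Set ι) := by simp
  have hpow : ∀ (M : ℕ) (s : Set ι), k ∉ s → ∀ p, G k ^ M * p ∈ Ideal.span (G '' s) →
      p ∈ Ideal.span (G '' s) := by
    intro M s hs p
    induction M with
    | zero => simp
    | succ M ihM =>
      intro h
      refine ihM (hG s k hs _ ?_)
      convert h using 1
      ring
  have hb := hG.mem_span_of_mul_mem he hpos (k := k) (b := G' k) (fun p hp => by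
    refine hpow M _ hk p ?_
    have h1 : Set.range G' = G' '' insert k {k}ᶜ := by
      rw [← Set.image_univ]; congr 1; ext x; simp [em]
    rw [h1] at hM
    obtain ⟨z, hz⟩ := IsRegularFamily.exists_eq_mul_add hM
    rw [himg _ hk] at hz
    have : G k ^ M * p = (G k ^ M - G' k * z) * p + z * (G' k * p) := by ring
    rw [this]
    exact add_mem (Ideal.mul_mem_right _ _ hz) (Ideal.mul_mem_left _ _ hp))
  intro s j hj p hp
  by_cases hks : k ∈ s
  · have hjk : j ≠ k := fun h => hj (h ▸ hks)
    obtain ⟨t, hkt, rfl⟩ : ∃ t, k ∉ t ∧ s = insert k t :=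
      ⟨s \ {k}, by simp, by simp [Set.insert_eq_of_mem hks]⟩
    have hjt : j ∉ t := fun h => hj (Set.mem_insert_of_mem _ h)
    obtain ⟨y, hy⟩ := IsRegularFamily.exists_eq_mul_add hp
    rw [himg _ hkt, hGG' j hjk] at hy
    have hy1 : y ∈ Ideal.span (G '' insert j t) := by
      refine hb (insert j t) (by simp [hkt, hjk.symm]) y ?_
      have : G' k * y = G j * p - (G j * p - G' k * y) := by ring
      rw [this]
      refine sub_mem (Ideal.mul_mem_right _ _ (Ideal.subset_span ⟨j, by simp, rfl⟩))
        (Ideal.span_mono (Set.image_mono (Set.subset_insert _ _)) hy)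
    obtain ⟨z, hz⟩ := IsRegularFamily.exists_eq_mul_add hy1
    have h2 : p - G' k * z ∈ Ideal.span (G '' t) := by
      refine hG t j hjt _ ?_
      have : G j * (p - G' k * z) = (G j * p - G' k * y) + G' k * (y - G j * z) := by ring
      rw [this]
      exact add_mem hy (Ideal.mul_mem_left _ _ hz)
    rw [← himg t hkt] at h2
    have : p = (p - G' k * z) + G' k * z := by ring
    rw [this]
    refine add_mem (Ideal.span_mono (Set.image_mono (Set.subset_insert _ _)) h2)
      (Ideal.mul_mem_right _ _ (Ideal.subset_span ⟨k, by simp, rfl⟩))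
  · rw [himg s hks] at hp ⊢
    by_cases hjk : j = k
    · subst hjk; exact hb s hks p hp
    · rw [hGG' j hjk] at hp
      exact hG s j hj p hp

lemma isRegularFamily_X : IsRegularFamily (fun i : τ => (X i : MvPolynomial τ 𝕜)) := by
  intro s k hk p hp
  rw [mem_ideal_span_X_image] at hp ⊢
  intro m hm
  obtain ⟨i, hi, hi'⟩ := hp (m + Finsupp.single k 1) (by
    rw [mem_support_iff, add_comm, coeff_X_mul]; exact mem_support_iff.1 hm)
  refine ⟨i, hi, ?_⟩
  have : k ≠ i := fun h => hk (h ▸ hi)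
  simpa [Finsupp.single_apply, this] using hi'

end Graded

section SystemOfParameters

variable {τ ι : Type*}

lemma exists_pow_mem_of_forall_eval [Finite τ] {J : Ideal (MvPolynomial τ ℂ)}
    {p : MvPolynomial τ ℂ} (h : ∀ x, (∀ g ∈ J, eval x g = 0) → eval x p = 0) :
    ∃ M : ℕ, p ^ M ∈ J := by
  have : p ∈ J.radical := by
    rw [← vanishingIdeal_zeroLocus_eq_radical (K := ℂ), mem_vanishingIdeal_iff]
    intro x hx
    simpa [aeval_eq_eval] using h x fun g hg => by simpa [aeval_eq_eval] using hx g hg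
  exact this

lemma exists_pow_idealOfVars_le [Finite τ] {J : Ideal (MvPolynomial τ ℂ)}
    (h : ∀ x, (∀ g ∈ J, eval x g = 0) → x = 0) : ∃ L : ℕ, idealOfVars τ ℂ ^ L ≤ J := by
  refine Ideal.exists_pow_le_of_le_radical_of_fg ?_ (idealOfVars_fg τ ℂ)
  rw [idealOfVars, Ideal.span_le]
  rintro _ ⟨i, rfl⟩
  exact exists_pow_mem_of_forall_eval fun x hx => by simp [h x hx]

/-- A family of polynomials whose only common zero is the origin. -/
def OnlyZeroAtOrigin (G : ι → MvPolynomial τ ℂ) : Prop :=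
  ∀ x, (∀ j, eval x (G j) = 0) → x = 0

lemma OnlyZeroAtOrigin.exists_pow_le [Finite τ] {G : ι → MvPolynomial τ ℂ}
    (hG : OnlyZeroAtOrigin G) : ∃ L : ℕ, idealOfVars τ ℂ ^ L ≤ Ideal.span (Set.range G) :=
  exists_pow_idealOfVars_le fun x hx => hG x fun j => hx _ (Ideal.subset_span ⟨j, rfl⟩)

lemma OnlyZeroAtOrigin.exists_totalDegree_le {G : ι → MvPolynomial τ ℂ} {e : ι → ℕ}
    (he : ∀ j, (G j).IsHomogeneous (e j)) (hpos : ∀ j, 0 < e j) (k : ι) {L : ℕ}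
    (hL : idealOfVars τ ℂ ^ L ≤ Ideal.span (Set.range G)) (D : ℕ) :
    ∀ p : MvPolynomial τ ℂ, p.IsHomogeneous D → ∃ r : MvPolynomial τ ℂ, r.totalDegree ≤ L ∧
      p - r ∈ Ideal.span (G '' {k}ᶜ ∪ {G k - 1}) := by
  induction D using Nat.strong_induction_on with
  | _ D ih =>
  intro p hp
  by_cases hDL : D < L
  · exact ⟨p, hp.totalDegree_le.trans hDL.le, by simp⟩
  have hpJ : p ∈ Ideal.span (Set.range G) := hL <| by
    rw [mem_pow_idealOfVars_iff]
    intro x hx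
    have := hp (mem_support_iff.1 hx)
    rw [Finsupp.degree_eq_weight_one]
    exact (not_lt.1 hDL).trans_eq this.symm
  have h1 : Set.range G = G '' insert k {k}ᶜ := by
    rw [← Set.image_univ]; congr 1; ext x; simp [em]
  rw [h1] at hpJ
  obtain ⟨z, hz⟩ := IsRegularFamily.exists_eq_mul_add hpJ
  have hle : Ideal.span (G '' {k}ᶜ) ≤ Ideal.span (G '' {k}ᶜ ∪ {G k - 1}) :=
    Ideal.span_mono Set.subset_union_left
  have hk : G k - 1 ∈ Ideal.span (G '' {k}ᶜ ∪ {G k - 1}) := Ideal.subset_span (by simp)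
  have hz' := homogeneousComponent_mem_span (S := G '' {k}ᶜ)
    (by rintro _ ⟨l, -, rfl⟩; exact ⟨_, he l⟩) hz D
  rw [map_sub, homogeneousComponent_of_mem ((mem_homogeneousSubmodule _ _).2 hp), if_pos rfl,
    mul_comm] at hz'
  by_cases hDe : e k ≤ D
  · obtain ⟨D', rfl⟩ := Nat.exists_eq_add_of_le' hDe
    rw [homogeneousComponent_mul_right (he k)] at hz'
    obtain ⟨r, hr, hr'⟩ := ih D' (by have := hpos k; omega) (homogeneousComponent D' z)
      (homogeneousComponent_isHomogeneous _ _)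
    refine ⟨r, hr, ?_⟩
    have : p - r = (p - homogeneousComponent D' z * G k) + homogeneousComponent D' z * (G k - 1)
      + (homogeneousComponent D' z - r) := by ring
    rw [this]
    exact add_mem (add_mem (hle hz') (Ideal.mul_mem_left _ _ hk)) hr'
  · rw [homogeneousComponent_mul_right_of_lt (he k) (by omega)] at hz'
    exact ⟨0, by simp, hle hz'⟩

lemma OnlyZeroAtOrigin.finite_setOf [Finite τ] {G : ι → MvPolynomial τ ℂ} {e : ι → ℕ}
    (hG : OnlyZeroAtOrigin G)
    (he : ∀ j, (G j).IsHomogeneous (e j)) (hpos : ∀ j, 0 < e j) (k : ι) :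
    {x : τ → ℂ | (∀ j ≠ k, eval x (G j) = 0) ∧ eval x (G k) = 1}.Finite := by
  obtain ⟨L, hL⟩ := hG.exists_pow_le
  set K := Ideal.span (G '' {k}ᶜ ∪ {G k - 1}) with hK
  have key : ∀ p : MvPolynomial τ ℂ, ∃ r : MvPolynomial τ ℂ, r.totalDegree ≤ L ∧ p - r ∈ K := by
    intro p
    choose r hr hr' using fun D => OnlyZeroAtOrigin.exists_totalDegree_le he hpos k hL D
      (homogeneousComponent D p) (homogeneousComponent_isHomogeneous _ _)
    refine ⟨∑ D ∈ Finset.range (p.totalDegree + 1), r D,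
      totalDegree_finsetSum_le fun D _ => hr D, ?_⟩
    nth_rw 1 [← sum_homogeneousComponent p]
    rw [← Finset.sum_sub_distrib]
    exact K.sum_mem fun D _ => hr' D
  have hfin : Module.Finite ℂ (MvPolynomial τ ℂ ⧸ K) := by
    refine Module.Finite.of_surjective
      ((Ideal.Quotient.mkₐ ℂ K).toLinearMap ∘ₗ (restrictTotalDegree τ ℂ L).subtype) ?_
    intro q
    obtain ⟨p, rfl⟩ := Ideal.Quotient.mk_surjective q
    obtain ⟨r, hr, hr'⟩ := key p
    exact ⟨⟨r, (mem_restrictTotalDegree _ _ _).2 hr⟩, (Ideal.Quotient.eq.2 hr').symm⟩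
  have hint : ∀ i : τ, ∃ P : Polynomial ℂ, P.Monic ∧ Polynomial.aeval (X i) P ∈ K := by
    intro i
    obtain ⟨P, hP, hP'⟩ := Algebra.IsIntegral.isIntegral (R := ℂ) (Ideal.Quotient.mkₐ ℂ K (X i))
    refine ⟨P, hP, ?_⟩
    rw [← Ideal.Quotient.eq_zero_iff_mem]
    rw [← Polynomial.aeval_def, Polynomial.aeval_algHom_apply] at hP'
    exact hP'
  choose P hP hPK using hint
  refine (Set.Finite.pi' (t := fun i => {c | (P i).IsRoot c})
    fun i => Polynomial.finite_setOfPred_isRoot (hP i).ne_zero).subset ?_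
  intro x hx i
  have hK0 : ∀ q ∈ K, eval x q = 0 := by
    intro q hq
    rw [← RingHom.mem_ker]
    revert q
    change K ≤ _
    rw [hK, Ideal.span_le]
    rintro _ (⟨j, hj, rfl⟩ | rfl)
    · exact hx.1 j hj
    · simp [RingHom.mem_ker, hx.2]
  have := hK0 _ (hPK i)
  have h2 : eval x (Polynomial.aeval (X i) (P i)) = Polynomial.aeval (x i) (P i) := by
    have := Polynomial.aeval_algHom_apply (aeval x : MvPolynomial τ ℂ →ₐ[ℂ] ℂ) (X i) (P i)
    simpa [aeval_eq_eval] using this.symm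
  rw [h2] at this
  simpa [Polynomial.aeval_def, Polynomial.IsRoot] using this

lemma exists_linear_ne_zero [Fintype τ] {Z : Set (τ → ℂ)} (hZ : Z.Finite) (h0 : 0 ∉ Z) :
    ∃ c : τ → ℂ, ∀ z ∈ Z, eval z (∑ i, C (c i) * X i) ≠ 0 := by
  have := hZ.to_subtype
  obtain ⟨l, hl⟩ := Module.exists_dual_forall_apply_ne_zero (K := ℂ) (fun z : Z => (z : τ → ℂ))
    (fun z h => h0 (h ▸ z.2))
  classical
  refine ⟨fun i => l (Pi.single i 1), fun z hz => ?_⟩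
  have : l z ≠ 0 := hl ⟨z, hz⟩
  rw [← Finset.univ_sum_single z, map_sum] at this
  convert this using 1
  rw [map_sum]
  refine Finset.sum_congr rfl fun i _ => ?_
  have h : (Pi.single i (z i) : τ → ℂ) = z i • Pi.single i 1 := by
    rw [← Pi.single_smul, smul_eq_mul, mul_one]
  simp [h, mul_comm]

lemma isHomogeneous_linear [Fintype τ] (c : τ → ℂ) :
    (∑ i, C (c i) * X i : MvPolynomial τ ℂ).IsHomogeneous 1 := by
  refine IsHomogeneous.sum _ _ _ fun i _ => ?_
  simpa using (isHomogeneous_C τ (c i)).mul (isHomogeneous_X ℂ i)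

lemma eval_smul_of_isHomogeneous {p : MvPolynomial τ ℂ} {m : ℕ} (hp : p.IsHomogeneous m)
    (c : ℂ) (x : τ → ℂ) : eval (c • x) p = c ^ m * eval x p := by
  rw [eval_eq, eval_eq, Finset.mul_sum]
  refine Finset.sum_congr rfl fun α hα => ?_
  have : ∑ i ∈ α.support, α i = m := by
    have := hp (mem_support_iff.1 hα)
    simpa [Finsupp.weight_apply, Finsupp.sum] using this
  simp only [Pi.smul_apply, smul_eq_mul, mul_pow, Finset.prod_mul_distrib]
  rw [Finset.prod_pow_eq_pow_sum, this]
  ring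

lemma OnlyZeroAtOrigin.update [DecidableEq ι] {G : ι → MvPolynomial τ ℂ} {e : ι → ℕ}
    (hG : OnlyZeroAtOrigin G) (he : ∀ j, (G j).IsHomogeneous (e j)) (hpos : ∀ j, 0 < e j)
    {k : ι} {y : MvPolynomial τ ℂ} (hy : y.IsHomogeneous 1)
    (hyZ : ∀ x ∈ {x : τ → ℂ | (∀ j ≠ k, eval x (G j) = 0) ∧ eval x (G k) = 1}, eval x y ≠ 0) :
    OnlyZeroAtOrigin (Function.update G k y) := by
  intro x hx
  by_contra hx0
  have hj : ∀ j ≠ k, eval x (G j) = 0 := fun j hj => by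
    have := hx j; rwa [Function.update_of_ne hj] at this
  have hk : eval x (G k) ≠ 0 := fun hk => hx0 <| hG x fun j => by
    by_cases h : j = k
    · rw [h, hk]
    · exact hj j h
  obtain ⟨c, hc⟩ := IsAlgClosed.exists_pow_nat_eq (eval x (G k))⁻¹ (hpos k)
  refine hyZ (c • x) ⟨fun j h => ?_, ?_⟩ ?_
  · rw [eval_smul_of_isHomogeneous (he j), hj j h, mul_zero]
  · rw [eval_smul_of_isHomogeneous (he k), hc, inv_mul_cancel₀ hk]
  · have := hx k
    rw [Function.update_self] at this
    rw [eval_smul_of_isHomogeneous hy, this, mul_zero]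

/-- A family of `m` forms in `m` variables whose only common zero is the origin is regular. -/
lemma OnlyZeroAtOrigin.isRegularFamily {m : ℕ} {G : Fin m → MvPolynomial (Fin m) ℂ}
    {e : Fin m → ℕ} (hG : OnlyZeroAtOrigin G) (he : ∀ j, (G j).IsHomogeneous (e j))
    (hpos : ∀ j, 0 < e j) : IsRegularFamily G := by
  have key : ∀ l ≤ m, ∀ (G G' : Fin m → MvPolynomial (Fin m) ℂ) (e e' : Fin m → ℕ),
      OnlyZeroAtOrigin G → OnlyZeroAtOrigin G' → (∀ j, (G j).IsHomogeneous (e j)) →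
      (∀ j, (G' j).IsHomogeneous (e' j)) → (∀ j, 0 < e j) → (∀ j, 0 < e' j) →
      (∀ j : Fin m, l ≤ j → G j = G' j) → IsRegularFamily G → IsRegularFamily G' := by
    intro l
    induction l with
    | zero =>
      intro _ G G' e e' _ _ _ _ _ _ h hr
      rwa [← funext fun j => h j (Nat.zero_le _)]
    | succ l ih =>
      intro hl G G' e e' hG hG' he he' hpos hpos' h hr
      set k : Fin m := ⟨l, hl⟩
      obtain ⟨c, hc⟩ := exists_linear_ne_zero
        ((hG.finite_setOf he hpos k).union (hG'.finite_setOf he' hpos' k)) (by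
          have hz : ∀ {p : MvPolynomial (Fin m) ℂ} {a : ℕ}, p.IsHomogeneous a → 0 < a →
            eval 0 p = 0 := fun {p a} hp ha => by
              have := eval_smul_of_isHomogeneous hp 0 0
              rwa [smul_zero, zero_pow ha.ne', zero_mul] at this
          rintro (⟨-, h0⟩ | ⟨-, h0⟩)
          · rw [hz (he k) (hpos k)] at h0; exact zero_ne_one h0
          · rw [hz (he' k) (hpos' k)] at h0; exact zero_ne_one h0)
      set y := (∑ i, C (c i) * X i : MvPolynomial (Fin m) ℂ)
      have hy : y.IsHomogeneous 1 := isHomogeneous_linear c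
      have hGy := hG.update he hpos hy fun x hx => hc x (Or.inl hx)
      have hGy' := hG'.update he' hpos' hy fun x hx => hc x (Or.inr hx)
      have hhom : ∀ (G : Fin m → MvPolynomial (Fin m) ℂ) (e : Fin m → ℕ),
          (∀ j, (G j).IsHomogeneous (e j)) → ∀ j, (Function.update G k y j).IsHomogeneous
            (Function.update e k 1 j) := by
        intro G e he j
        by_cases hj : j = k
        · subst hj; simpa using hy
        · simpa [hj] using he j
      have hposu : ∀ (e : Fin m → ℕ), (∀ j, 0 < e j) → ∀ j, 0 < Function.update e k 1 j := by
        intro e he j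
        by_cases hj : j = k
        · subst hj; simp
        · simpa [hj] using he j
      have hpow : ∀ {H K : Fin m → MvPolynomial (Fin m) ℂ} {b : ℕ}, (H k).IsHomogeneous b →
          0 < b → OnlyZeroAtOrigin K → ∃ M : ℕ, H k ^ M ∈ Ideal.span (Set.range K) := by
        intro H K b hb hb0 hK
        refine exists_pow_mem_of_forall_eval fun x hx => ?_
        have : x = 0 := hK x fun j => hx _ (Ideal.subset_span ⟨j, rfl⟩)
        rw [this]
        have := eval_smul_of_isHomogeneous hb 0 0
        rwa [smul_zero, zero_pow hb0.ne', zero_mul] at this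
      obtain ⟨M, hM⟩ := hpow (he k) (hpos k) hGy
      have h1 : IsRegularFamily (Function.update G k y) :=
        hr.exchange he hpos (fun j hj => by simp [hj]) hM
      have h2 : IsRegularFamily (Function.update G' k y) :=
        ih (by omega) _ _ _ _ hGy hGy' (hhom G e he) (hhom G' e' he') (hposu e hpos)
          (hposu e' hpos') (fun j hj => by
            by_cases hjk : j = k
            · subst hjk; simp
            · have : l + 1 ≤ j := by
                have : (j : ℕ) ≠ l := fun h => hjk (Fin.ext h)
                omega
              simp [hjk, h j this]) h1
      obtain ⟨M, hM⟩ := hpow (H := Function.update G' k y) (hhom G' e' he' k)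
        (hposu e' hpos' k) hG'
      exact h2.exchange (hhom G' e' he') (hposu e' hpos') (fun j hj => by simp [hj]) hM
  exact key m le_rfl (fun i => X i) G (fun _ => 1) e
    (fun x hx => funext fun i => by simpa using hx i) hG (fun j => isHomogeneous_X ℂ j) he
    (fun _ => one_pos) hpos (fun j hj => absurd j.2 (by omega)) isRegularFamily_X

end SystemOfParameters

section Syzygies

variable {τ ι : Type*}

lemma IsRegularFamily.comp {A : Type*} {κ : Type*} [CommRing A] {G : ι → A}
    (hG : IsRegularFamily G) {φ : κ → ι} (hφ : Function.Injective φ) :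
    IsRegularFamily (fun j => G (φ j)) := by
  intro s k hk p hp
  have h : (fun j => G (φ j)) '' s = G '' (φ '' s) := by rw [Set.image_image]
  rw [h] at hp ⊢
  exact hG _ _ (fun h => hk (by simpa [hφ.eq_iff] using h)) _ hp

lemma exists_isHomogeneous_coeff [Fintype ι] {g : ι → MvPolynomial τ ℂ} {e r : ℕ}
    (hg : ∀ j, (g j).IsHomogeneous e) {p : MvPolynomial τ ℂ} (hp : p.IsHomogeneous (r + e))
    (hpI : p ∈ Ideal.span (Set.range g)) :
    ∃ c : ι → MvPolynomial τ ℂ, (∀ j, (c j).IsHomogeneous r) ∧ p = ∑ j, c j * g j := by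
  obtain ⟨c, hc⟩ := Ideal.mem_span_range_iff_exists_fun.1 hpI
  refine ⟨fun j => homogeneousComponent r (c j), fun j => homogeneousComponent_isHomogeneous _ _, ?_⟩
  have := congrArg (homogeneousComponent (r + e)) hc
  rw [homogeneousComponent_of_mem ((mem_homogeneousSubmodule _ _).2 hp), if_pos rfl, map_sum] at this
  rw [← this]
  exact Finset.sum_congr rfl fun j _ => homogeneousComponent_mul_right (hg j) r

lemma eq_zero_of_mem_span_of_isHomogeneous [Finite ι] {g : ι → MvPolynomial τ ℂ} {e r : ℕ}
    (hg : ∀ j, (g j).IsHomogeneous e) {p : MvPolynomial τ ℂ} (hp : p.IsHomogeneous r)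
    (hr : r < e) (hpI : p ∈ Ideal.span (Set.range g)) : p = 0 := by
  have := Fintype.ofFinite ι
  obtain ⟨c, hc⟩ := Ideal.mem_span_range_iff_exists_fun.1 hpI
  have := congrArg (homogeneousComponent r) hc
  rw [homogeneousComponent_of_mem ((mem_homogeneousSubmodule _ _).2 hp), if_pos rfl, map_sum] at this
  rw [← this]
  exact Finset.sum_eq_zero fun j _ => homogeneousComponent_mul_right_of_lt (hg j) hr

lemma IsRegularFamily.mem_span_of_sum_eq_zero {A : Type*} [CommRing A] [Fintype ι] {g : ι → A}
    (hg : IsRegularFamily g) {c : ι → A} (hc : ∑ j, c j * g j = 0) (j : ι) :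
    c j ∈ Ideal.span (Set.range g) := by
  classical
  have : c j ∈ Ideal.span (g '' {j}ᶜ) := by
    refine hg _ j (by simp) _ ?_
    rw [← Finset.add_sum_erase _ _ (Finset.mem_univ j)] at hc
    rw [mul_comm, eq_neg_of_add_eq_zero_left hc]
    refine neg_mem (Ideal.sum_mem _ fun l hl => Ideal.mul_mem_left _ _ ?_)
    exact Ideal.subset_span ⟨l, by simpa using Finset.ne_of_mem_erase hl, rfl⟩
  exact Ideal.span_mono (Set.image_subset_range _ _) this

/-- The linear form cutting out, together with its analogues, the line through a point whose
`m`-th coordinate is nonzero. -/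
def slopeForm (m : Fin (n + 1)) (t : Fin n → ℂ) (k : Fin n) : MvPolynomial (Fin (n + 1)) ℂ :=
  X (m.succAbove k) - C (t k) * X m

lemma isHomogeneous_slopeForm (m : Fin (n + 1)) (t : Fin n → ℂ) (k : Fin n) :
    (slopeForm m t k).IsHomogeneous 1 :=
  (isHomogeneous_X ℂ _).sub (by simpa using (isHomogeneous_C _ (t k)).mul (isHomogeneous_X ℂ m))

lemma eval_aeval {κ : Type*} (x : κ → ℂ) (s : τ → MvPolynomial κ ℂ) (p : MvPolynomial τ ℂ) :
    eval x (aeval s p) = eval (fun i => eval x (s i)) p := by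
  induction p using MvPolynomial.induction_on with
  | C a => simp
  | add p q hp hq => rw [map_add, map_add, hp, hq, map_add]
  | mul_X p i hp => rw [map_mul, map_mul, hp, aeval_X, map_mul, eval_X]

lemma sub_aeval_mem {J : Ideal (MvPolynomial τ ℂ)} {s : τ → MvPolynomial τ ℂ}
    (hs : ∀ i, X i - s i ∈ J) (p : MvPolynomial τ ℂ) : p - aeval s p ∈ J := by
  rw [← Ideal.Quotient.eq]
  have : (Ideal.Quotient.mkₐ ℂ J) = (Ideal.Quotient.mkₐ ℂ J).comp (aeval s) := by
    ext i
    simpa using Ideal.Quotient.eq.2 (hs i)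
  exact DFunLike.congr_fun this p

lemma mem_span_of_slopeForm_mul_mem (hn : 3 ≤ n) {e : ℕ} (he : 2 ≤ e)
    {g : Fin n → MvPolynomial (Fin (n + 1)) ℂ} (hg : ∀ j, (g j).IsHomogeneous e)
    {g₀ : MvPolynomial (Fin (n + 1)) ℂ} (hg₀ : g₀.IsHomogeneous e) (hreg : IsRegularFamily g)
    (m : Fin (n + 1)) (t : Fin n → ℂ)
    (ha : ∀ k, slopeForm m t k * g₀ ∈ Ideal.span (Set.range g)) :
    g₀ ∈ Ideal.span (Set.range g) := by
  set a := slopeForm m t with ha_def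
  have hadeg : ∀ k, (a k).IsHomogeneous 1 := isHomogeneous_slopeForm m t
  choose M hM hMg using fun k => exists_isHomogeneous_coeff hg ((hadeg k).mul hg₀) (ha k)
  have hc : ∀ i k j, ∃ T : Fin n → ℂ, a k * M i j - a i * M k j = ∑ l, C (T l) * g l := by
    intro i k j
    have hI : a k * M i j - a i * M k j ∈ Ideal.span (Set.range g) := by
      refine hreg.mem_span_of_sum_eq_zero (c := fun j => a k * M i j - a i * M k j) ?_ j
      have h1 : ∑ j, (a k * M i j - a i * M k j) * g j =
          a k * ∑ j, M i j * g j - a i * ∑ j, M k j * g j := by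
        rw [Finset.mul_sum, Finset.mul_sum, ← Finset.sum_sub_distrib]
        exact Finset.sum_congr rfl fun j _ => by ring
      rw [h1, ← hMg, ← hMg]
      ring
    have hd : (a k * M i j - a i * M k j).IsHomogeneous 2 :=
      ((hadeg k).mul (hM i j)).sub ((hadeg i).mul (hM k j))
    rcases he.eq_or_lt with rfl | he
    · obtain ⟨c, hc, hc'⟩ := exists_isHomogeneous_coeff (r := 0) hg (by simpa using hd) hI
      refine ⟨fun l => coeff 0 (c l), hc'.trans (Finset.sum_congr rfl fun l _ => ?_)⟩
      rw [← totalDegree_eq_zero_iff_eq_C.1 (Nat.le_zero.1 (hc l).totalDegree_le)]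
    · exact ⟨0, by rw [eq_zero_of_mem_span_of_isHomogeneous hg hd he hI]; simp⟩
  choose T hT using hc
  let i₀ : Fin n := ⟨0, by omega⟩
  let i₁ : Fin n := ⟨1, by omega⟩
  let i₂ : Fin n := ⟨2, by omega⟩
  have h01 : i₀ ≠ i₁ := by simp [i₀, i₁]
  have h02 : i₀ ≠ i₂ := by simp [i₀, i₂]
  have h12 : i₁ ≠ i₂ := by simp [i₁, i₂]
  have hT0 : ∀ j l, T i₀ i₁ j l = 0 := by
    intro j l
    set c : Fin n → MvPolynomial (Fin (n + 1)) ℂ := fun l =>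
      a i₂ * C (T i₀ i₁ j l) + a i₀ * C (T i₁ i₂ j l) + a i₁ * C (T i₂ i₀ j l)
    have hsum : ∑ l, c l * g l = 0 := by
      have : ∑ l, c l * g l = a i₂ * ∑ l, C (T i₀ i₁ j l) * g l
          + a i₀ * ∑ l, C (T i₁ i₂ j l) * g l + a i₁ * ∑ l, C (T i₂ i₀ j l) * g l := by
        simp only [Finset.mul_sum, ← Finset.sum_add_distrib]
        exact Finset.sum_congr rfl fun l _ => by ring
      rw [this, ← hT, ← hT, ← hT]
      ring
    have hcl : c l = 0 := by
      refine eq_zero_of_mem_span_of_isHomogeneous hg (r := 1) ?_ he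
        (hreg.mem_span_of_sum_eq_zero hsum l)
      have hC : ∀ k (s : ℂ), (a k * C s).IsHomogeneous 1 := fun k s => by
        simpa using (hadeg k).mul (isHomogeneous_C _ s)
      exact ((hC _ _).add (hC _ _)).add (hC _ _)
    have := congrArg (eval (Pi.single (m.succAbove i₂) (1 : ℂ))) hcl
    simpa [c, ha_def, slopeForm, Pi.single_apply, h02, h12,
      Fin.succAbove_ne, (Fin.succAbove_ne m _).symm] using this
  let s : Fin (n + 1) → MvPolynomial (Fin (n + 1)) ℂ :=
    Function.update X (m.succAbove i₀) (C (t i₀) * X m)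
  have hs0 : aeval s (a i₀) = 0 := by
    simp [s, ha_def, slopeForm, (Fin.succAbove_ne m _).symm]
  have hs1 : aeval s (a i₁) = a i₁ := by
    simp [s, ha_def, slopeForm, (Fin.succAbove_ne m _).symm, h01.symm]
  have ha1 : a i₁ ≠ 0 := by
    intro h
    have := congrArg (eval (Pi.single (m.succAbove i₁) (1 : ℂ))) h
    simp [ha_def, slopeForm, (Fin.succAbove_ne m _).symm] at this
  have hdvd : ∀ j, ∃ c, M i₀ j = a i₀ * c := by
    intro j
    have h1 : a i₁ * M i₀ j - a i₀ * M i₁ j = 0 := by rw [hT]; simp [hT0]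
    have h2 := congrArg (aeval s) h1
    rw [map_sub, map_mul, map_mul, hs0, hs1, zero_mul, sub_zero, map_zero] at h2
    have h3 : aeval s (M i₀ j) = 0 := (mul_eq_zero.1 h2).resolve_left ha1
    have h4 := sub_aeval_mem (J := Ideal.span {a i₀}) (s := s) (fun i => by
      by_cases hi : i = m.succAbove i₀
      · subst hi
        simpa [s] using Ideal.subset_span (by simp [ha_def, slopeForm])
      · simp [s, hi]) (M i₀ j)
    rw [h3, sub_zero] at h4
    exact Ideal.mem_span_singleton.1 h4
  choose c hc using hdvd
  have ha0 : a i₀ ≠ 0 := by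
    intro h
    have := congrArg (eval (Pi.single (m.succAbove i₀) (1 : ℂ))) h
    simp [ha_def, slopeForm, (Fin.succAbove_ne m _).symm] at this
  have : g₀ = ∑ j, c j * g j := by
    refine mul_left_cancel₀ ha0 ?_
    rw [hMg, Finset.mul_sum]
    exact Finset.sum_congr rfl fun j _ => by rw [hc]; ring
  rw [this]
  exact Ideal.sum_mem _ fun j _ => Ideal.mul_mem_left _ _ (Ideal.subset_span ⟨j, rfl⟩)

/-- At a reduced point of the zero scheme of the `g j`, the maximal ideal is generated by them. -/
lemma exists_mul_slopeForm_mem {e : ℕ} {g : Fin n → MvPolynomial (Fin (n + 1)) ℂ}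
    (hg : ∀ j, (g j).IsHomogeneous e) {m : Fin (n + 1)} {q : Fin (n + 1) → ℂ} (hqm : q m ≠ 0)
    (hgq : ∀ j, eval q (g j) = 0)
    (hind : ∀ v : Fin n → ℂ, (∀ i, ∑ j, v j * eval q (pderiv i (g j)) = 0) → v = 0) :
    ∃ u, eval q u ≠ 0 ∧
      ∀ k, u * slopeForm m (fun k => q (m.succAbove k) / q m) k ∈ Ideal.span (Set.range g) := by
  set t : Fin n → ℂ := fun k => q (m.succAbove k) / q m with ht
  set a := slopeForm m t with ha_def
  have haq : ∀ k, eval q (a k) = 0 := fun k => by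
    simp only [ha_def, slopeForm, ht, map_sub, map_mul, eval_X, eval_C]
    field_simp
    simp
  have hmem : ∀ j, g j ∈ Ideal.span (Set.range a) := by
    intro j
    let s : Fin (n + 1) → MvPolynomial (Fin (n + 1)) ℂ := fun i => C (q i / q m) * X m
    have h1 := sub_aeval_mem (J := Ideal.span (Set.range a)) (s := s) (fun i => by
      by_cases hi : i = m
      · subst hi; simp [s, hqm]
      · obtain ⟨k, rfl⟩ := Fin.exists_succAbove_eq hi
        exact Ideal.subset_span ⟨k, rfl⟩) (g j)
    have h2 : aeval s (g j) = 0 := by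
      refine MvPolynomial.funext fun x => ?_
      have : eval x (aeval s (g j)) = eval ((x m / q m) • q) (g j) := by
        rw [eval_aeval]
        congr 2
        ext i
        simp [s]
        ring
      rw [this, eval_smul_of_isHomogeneous (hg j), hgq, mul_zero, map_zero]
    rwa [h2, sub_zero] at h1
  choose A hA using fun j => Ideal.mem_span_range_iff_exists_fun.1 (hmem j)
  let N : Matrix (Fin n) (Fin n) (MvPolynomial (Fin (n + 1)) ℂ) := Matrix.of A
  refine ⟨N.det, ?_, fun k => ?_⟩
  · intro h
    rw [RingHom.map_det] at h
    obtain ⟨v, hv, hv0⟩ := Matrix.exists_vecMul_eq_zero_iff.2 h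
    refine hv (hind v fun i => ?_)
    have h1 : ∀ j, eval q (pderiv i (g j)) = ∑ k, eval q (A j k) * eval q (pderiv i (a k)) := by
      intro j
      rw [← hA j]
      simp [haq]
    simp only [h1, Finset.mul_sum]
    rw [Finset.sum_comm]
    refine Finset.sum_eq_zero fun k _ => ?_
    have := congrFun hv0 k
    simp only [Matrix.vecMul, dotProduct, Pi.zero_apply] at this
    simp only [← mul_assoc, ← Finset.sum_mul]
    simp [N] at this
    rw [this, zero_mul]
  · have h1 : N.mulVec a = g := funext fun j => by simpa [N, Matrix.mulVec, dotProduct] using hA j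
    have h2 : N.det * a k = (N.adjugate.mulVec g) k := by
      rw [← h1, Matrix.mulVec_mulVec, Matrix.adjugate_mul, Matrix.smul_mulVec, Matrix.one_mulVec]
      rfl
    rw [h2, Matrix.mulVec, dotProduct]
    exact Ideal.sum_mem _ fun j _ => Ideal.mul_mem_left _ _ (Ideal.subset_span ⟨j, rfl⟩)

lemma exists_mul_mem_smul {S : Set (MvPolynomial τ ℂ)} (hS : ∀ g ∈ S, ∃ m, g.IsHomogeneous m)
    {p u : MvPolynomial τ ℂ} {D : ℕ} (hp : p.IsHomogeneous D) (hu : u * p ∈ Ideal.span S)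
    {x : τ → ℂ} (hx : eval x u ≠ 0) {c : ℂ} (hc : c ≠ 0) :
    ∃ u', eval (c • x) u' ≠ 0 ∧ u' * p ∈ Ideal.span S := by
  obtain ⟨m, hm⟩ : ∃ m, eval x (homogeneousComponent m u) ≠ 0 := by
    by_contra! H
    refine hx ?_
    rw [← sum_homogeneousComponent u, map_sum]
    exact Finset.sum_eq_zero fun m _ => H m
  refine ⟨homogeneousComponent m u, ?_, ?_⟩
  · rw [eval_smul_of_isHomogeneous (homogeneousComponent_isHomogeneous _ _)]
    exact mul_ne_zero (pow_ne_zero _ hc) hm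
  · rw [← homogeneousComponent_mul_right hp]
    exact homogeneousComponent_mem_span hS hu _

theorem mem_span_of_local (hn : 3 ≤ n) {e : ℕ} (he : 2 ≤ e)
    {g : Fin n → MvPolynomial (Fin (n + 1)) ℂ} (hg : ∀ j, (g j).IsHomogeneous e)
    {g₀ : MvPolynomial (Fin (n + 1)) ℂ} (hg₀ : g₀.IsHomogeneous e)
    {q : Fin (n + 1) → ℂ} (hq : q ≠ 0) (hgq : ∀ j, eval q (g j) = 0)
    (hind : ∀ v : Fin n → ℂ, (∀ i, ∑ j, v j * eval q (pderiv i (g j)) = 0) → v = 0)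
    {S : Set (Fin (n + 1) → ℂ)} (hS : S.Finite) (hS0 : 0 ∉ S)
    (hgS : ∀ x, (∀ j, eval x (g j) = 0) → ∃ p ∈ S, ∃ c : ℂ, x = c • p)
    (hloc : ∀ p ∈ S, p = q ∨ ∃ u, eval p u ≠ 0 ∧ u * g₀ ∈ Ideal.span (Set.range g)) :
    g₀ ∈ Ideal.span (Set.range g) := by
  obtain ⟨b, hb⟩ := exists_linear_ne_zero hS hS0
  set l := (∑ i, C (b i) * X i : MvPolynomial (Fin (n + 1)) ℂ)
  have hl : l.IsHomogeneous 1 := isHomogeneous_linear b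
  have hreg : IsRegularFamily (Fin.cons l g : Fin (n + 1) → MvPolynomial (Fin (n + 1)) ℂ) := by
    refine OnlyZeroAtOrigin.isRegularFamily (e := Fin.cons 1 fun _ => e) ?_ ?_ ?_
    · intro x hx
      obtain ⟨p, hp, c, rfl⟩ := hgS x fun j => by simpa using hx j.succ
      have h0 : eval (c • p) l = 0 := by simpa using hx 0
      rw [eval_smul_of_isHomogeneous hl, pow_one] at h0
      rw [(mul_eq_zero.1 h0).resolve_right (hb p hp), zero_smul]
    · exact Fin.cases hl hg
    · exact Fin.cases (by simp) fun j => by simp; omega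
  have hregg : IsRegularFamily g := by simpa using hreg.comp (Fin.succ_injective n)
  have hlreg : ∀ (M : ℕ) (p : MvPolynomial (Fin (n + 1)) ℂ), l ^ M * p ∈ Ideal.span (Set.range g) →
      p ∈ Ideal.span (Set.range g) := by
    have himg : (Fin.cons l g : Fin (n + 1) → MvPolynomial (Fin (n + 1)) ℂ) '' Set.range Fin.succ =
        Set.range g := by
      rw [← Set.range_comp]; rfl
    intro M p
    induction M with
    | zero => simp
    | succ M ih =>
      intro h
      refine ih ?_
      have := hreg (Set.range Fin.succ) 0 (by simp) (l ^ M * p)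
      rw [himg, Fin.cons_zero] at this
      refine this ?_
      rwa [← mul_assoc, ← pow_succ']
  have hghom : ∀ p ∈ Set.range g, ∃ m, p.IsHomogeneous m := by
    rintro _ ⟨j, rfl⟩; exact ⟨e, hg j⟩
  obtain ⟨m, hm⟩ := Function.ne_iff.1 hq
  obtain ⟨w, hw, hwa⟩ := exists_mul_slopeForm_mem hg hm hgq hind
  refine mem_span_of_slopeForm_mul_mem hn he hg hg₀ hregg m
    (fun k => q (m.succAbove k) / q m) fun k => ?_
  set p := slopeForm m (fun k => q (m.succAbove k) / q m) k * g₀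
  have hp : p.IsHomogeneous (1 + e) := (isHomogeneous_slopeForm _ _ _).mul hg₀
  have key : ∀ x, (∀ j, eval x (g j) = 0) → x ≠ 0 →
      ∃ u, eval x u ≠ 0 ∧ u * p ∈ Ideal.span (Set.range g) := by
    intro x hx hx0
    obtain ⟨y, hy, c, rfl⟩ := hgS x hx
    have hc : c ≠ 0 := by rintro rfl; simp at hx0
    rcases hloc y hy with rfl | ⟨u, hu, hug⟩
    · refine exists_mul_mem_smul hghom hp (u := w) ?_ hw hc
      rw [← mul_assoc]
      exact Ideal.mul_mem_right _ _ (hwa k)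
    · refine exists_mul_mem_smul hghom hp (u := u) ?_ hu hc
      have : u * p = slopeForm m (fun k => q (m.succAbove k) / q m) k * (u * g₀) := by
        simp only [p]; ring
      rw [this]
      exact Ideal.mul_mem_left _ _ hug
  let J : Ideal (MvPolynomial (Fin (n + 1)) ℂ) :=
    Submodule.comap (LinearMap.toSpanSingleton _ _ p) (Ideal.span (Set.range g))
  have hJ : ∀ u, u ∈ J ↔ u * p ∈ Ideal.span (Set.range g) := fun u => Iff.rfl
  obtain ⟨M, hM⟩ := exists_pow_mem_of_forall_eval (J := J) (p := l) fun x hx => by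
    by_cases hx0 : x = 0
    · have := eval_smul_of_isHomogeneous hl 0 x
      rwa [zero_smul, ← hx0, pow_one, zero_mul] at this
    obtain ⟨u, hu, hup⟩ := key x (fun j => hx _ ((hJ _).2
      (Ideal.mul_mem_right _ _ (Ideal.subset_span ⟨j, rfl⟩)))) hx0
    exact absurd (hx u ((hJ u).2 hup)) hu
  exact hlreg M p ((hJ _).1 hM)

end Syzygies

section PolynomialCalculus

variable {τ : Type*} [Fintype τ]

/-- The total derivative of a polynomial function. -/
def evalFDeriv (p : MvPolynomial τ ℂ) (x : τ → ℂ) : (τ → ℂ) →L[ℂ] ℂ :=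
  ∑ i, eval x (pderiv i p) • ContinuousLinearMap.proj i

lemma evalFDeriv_apply (p : MvPolynomial τ ℂ) (x w : τ → ℂ) :
    evalFDeriv p x w = ∑ i, eval x (pderiv i p) * w i := by
  simp [evalFDeriv]

lemma hasFDerivAt_eval (p : MvPolynomial τ ℂ) (x : τ → ℂ) :
    HasFDerivAt (fun x => eval x p) (evalFDeriv p x) x := by
  classical
  induction p using MvPolynomial.induction_on with
  | C a =>
    have h1 : evalFDeriv (C a) x = 0 := by ext w; rw [evalFDeriv_apply]; simp
    simpa [h1] using hasFDerivAt_const a x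
  | add p q hp hq =>
    have h1 : evalFDeriv (p + q) x = evalFDeriv p x + evalFDeriv q x := by
      ext w
      rw [add_apply]
      simp only [evalFDeriv_apply]
      simp [add_mul, Finset.sum_add_distrib]
    simp only [h1, map_add]
    exact hp.fun_add hq
  | mul_X p i hp =>
    have h1 : evalFDeriv (p * X i) x =
        eval x p • ContinuousLinearMap.proj i + x i • evalFDeriv p x := by
      ext w
      rw [add_apply, smul_apply, smul_apply]
      simp only [evalFDeriv_apply,
        Derivation.leibniz, pderiv_X, ContinuousLinearMap.proj_apply, smul_eq_mul, map_add, map_mul,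
        eval_X, add_mul, Finset.sum_add_distrib, Finset.mul_sum, Pi.single_apply]
      congr 1
      · rw [Finset.sum_eq_single i]
        · simp
        · intro b _ hb; simp [hb.symm]
        · simp
      · exact Finset.sum_congr rfl fun _ _ => by ring
    simp only [h1, map_mul, eval_X]
    exact hp.fun_mul (hasFDerivAt_apply (𝕜 := ℂ) i x)

open MeasureTheory in
lemma volume_zeros_eq_zero {p : MvPolynomial τ ℂ} {m : ℕ} (hp : p.IsHomogeneous m) (h0 : p ≠ 0) :
    volume {x : τ → ℂ | eval x p = 0} = 0 := by
  obtain ⟨b, hb⟩ : ∃ b, eval b p ≠ 0 := by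
    by_contra! H
    exact h0 (MvPolynomial.funext fun x => by simpa using H x)
  have hmeas : MeasurableSet {x : τ → ℂ | eval x p ≠ 0} :=
    ((MvPolynomial.continuous_eval p).isOpen_preimage _ isOpen_ne).measurableSet
  have := ae_mem_of_ae_add_linearMap_mem (μ := (volume : Measure ℂ))
    (ν := (volume : Measure (τ → ℂ))) (L := LinearMap.toSpanSingleton ℂ (τ → ℂ) b) hmeas ?_
  · simpa [ae_iff] using this
  · intro y
    set P : Polynomial ℂ := aeval (fun i => Polynomial.C (y i) + Polynomial.X * Polynomial.C (b i)) p
    set Q : Polynomial ℂ := aeval (fun i => Polynomial.C (b i) + Polynomial.X * Polynomial.C (y i)) p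
    have hev : ∀ (c d : τ → ℂ) (t : ℂ), Polynomial.eval t
        (aeval (fun i => Polynomial.C (c i) + Polynomial.X * Polynomial.C (d i)) p) =
        eval (c + t • d) p := by
      intro c d t
      clear * -
      induction p using MvPolynomial.induction_on with
      | C a => simp
      | add p q hp hq => rw [map_add, Polynomial.eval_add, hp, hq, map_add]
      | mul_X p i hp =>
        rw [map_mul, Polynomial.eval_mul, hp, aeval_X, map_mul, eval_X]
        simp [mul_comm t]
    have hP : P ≠ 0 := by
      intro hP
      have hQ : Q = 0 := by
        refine Polynomial.eq_zero_of_infinite_isRoot _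
          ((Set.finite_singleton (0 : ℂ)).infinite_compl.mono fun s hs => ?_)
        have hs : s ≠ 0 := hs
        have h1 := hev y b s⁻¹
        change Polynomial.eval _ P = _ at h1
        rw [hP, Polynomial.eval_zero] at h1
        have h2 : b + s • y = s • (y + s⁻¹ • b) := by
          rw [smul_add, smul_inv_smul₀ hs, add_comm]
        change Polynomial.eval s Q = 0
        rw [hev, h2, eval_smul_of_isHomogeneous hp, ← h1, mul_zero]
      have := hev b y 0
      change Polynomial.eval _ Q = _ at this
      rw [hQ, Polynomial.eval_zero, zero_smul, add_zero] at this
      exact hb this.symm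
    have hfin : {t | P.IsRoot t}.Finite := Polynomial.finite_setOfPred_isRoot hP
    refine (ae_iff.2 (measure_mono_null ?_ (hfin.measure_zero volume)))
    intro t ht
    simp only [Set.mem_ofPred_eq, not_not] at ht
    change Polynomial.eval t P = 0
    rw [hev]
    exact ht

end PolynomialCalculus

section GenericTarget

lemma smul_rep_eq {v : Fin (n + 1) → ℂ} (hv : v ≠ 0) :
    ∃ a : ℂ, a ≠ 0 ∧ (Projectivization.mk ℂ v hv).rep = a • v := by
  obtain ⟨a, ha⟩ := Projectivization.exists_smul_eq_mk_rep ℂ v hv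
  exact ⟨a, a.ne_zero, ha.symm⟩

lemma eval_rep_mk_eq_zero_iff {p : MvPolynomial (Fin (n + 1)) ℂ} {m : ℕ} (hp : p.IsHomogeneous m)
    {v : Fin (n + 1) → ℂ} (hv : v ≠ 0) :
    eval (Projectivization.mk ℂ v hv).rep p = 0 ↔ eval v p = 0 := by
  obtain ⟨a, ha, h⟩ := smul_rep_eq hv
  rw [h, eval_smul_of_isHomogeneous hp]
  simp [ha]

/-- The gradient of a polynomial, as a map of the affine cone. -/
def gradMap (f : MvPolynomial (Fin (n + 1)) ℂ) (x : Fin (n + 1) → ℂ) : Fin (n + 1) → ℂ :=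
  fun i => eval x (pderiv i f)

/-- The derivative of the gradient map. -/
def gradFDeriv (f : MvPolynomial (Fin (n + 1)) ℂ) (x : Fin (n + 1) → ℂ) :
    (Fin (n + 1) → ℂ) →L[ℂ] (Fin (n + 1) → ℂ) :=
  ContinuousLinearMap.pi fun i => evalFDeriv (pderiv i f) x

lemma hasFDerivAt_gradMap (f : MvPolynomial (Fin (n + 1)) ℂ) (x : Fin (n + 1) → ℂ) :
    HasFDerivAt (gradMap f) (gradFDeriv f x) x :=
  hasFDerivAt_pi.2 fun i => hasFDerivAt_eval (pderiv i f) x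

lemma gradMap_smul {f : MvPolynomial (Fin (n + 1)) ℂ} {d : ℕ} (hf : f.IsHomogeneous d) (c : ℂ)
    (x : Fin (n + 1) → ℂ) : gradMap f (c • x) = c ^ (d - 1) • gradMap f x :=
  funext fun _ => eval_smul_of_isHomogeneous hf.pderiv c x

lemma exists_homogeneous_of_isZariskiOpenDense {U : Set (Proj n)} (hU : IsZariskiOpenDense U) :
    U.Nonempty ∧ ∃ (t : MvPolynomial (Fin (n + 1)) ℂ) (m : ℕ), t.IsHomogeneous m ∧ t ≠ 0 ∧
      ∀ (v : Fin (n + 1) → ℂ) (hv : v ≠ 0), eval v t ≠ 0 → Projectivization.mk ℂ v hv ∈ U := by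
  obtain ⟨⟨T, hT, hUT⟩, hdense⟩ := hU
  obtain ⟨u, hu, -⟩ := hdense Set.univ ⟨{1}, by
    rintro _ rfl; exact ⟨0, isHomogeneous_one _ _⟩, by ext; simp⟩
    ⟨Projectivization.mk ℂ (fun _ => 1) (fun h => one_ne_zero (congrFun h 0)), trivial⟩
  refine ⟨⟨u, hu⟩, ?_⟩
  have hu' : u ∉ Uᶜ := fun h => h hu
  rw [hUT] at hu'
  simp only [Set.mem_ofPred_eq, not_forall] at hu'
  obtain ⟨t, ht, htu⟩ := hu'
  obtain ⟨m, hm⟩ := hT t ht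
  refine ⟨t, m, hm, fun h => htu (by simp [h]), fun v hv hvt => ?_⟩
  by_contra hmem
  rw [← Set.mem_compl_iff, hUT] at hmem
  exact hvt ((eval_rep_mk_eq_zero_iff hm hv).1 (hmem t ht))

open MeasureTheory in
lemma volume_image_gradMap_zeros {f : MvPolynomial (Fin (n + 1)) ℂ} {d : ℕ}
    (hf : f.IsHomogeneous d) (h0 : f ≠ 0) : volume (gradMap f '' {x | eval x f = 0}) = 0 :=
  addHaar_image_eq_zero_of_differentiableOn_of_addHaar_eq_zero volume
    (fun x _ => ((hasFDerivAt_gradMap f x).restrictScalars ℝ).differentiableAt.differentiableWithinAt)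
    (volume_zeros_eq_zero hf h0)

open MeasureTheory in
lemma volume_criticalValues_gradMap (f : MvPolynomial (Fin (n + 1)) ℂ) :
    volume (gradMap f '' {x | ∃ w ≠ 0, gradFDeriv f x w = 0}) = 0 := by
  refine addHaar_image_eq_zero_of_det_fderivWithin_eq_zero volume
    (f' := fun x => (gradFDeriv f x).restrictScalars ℝ)
    (fun x _ => ((hasFDerivAt_gradMap f x).restrictScalars ℝ).hasFDerivWithinAt) ?_
  rintro x ⟨w, hw, hw0⟩
  rw [ContinuousLinearMap.det, LinearMap.det_eq_zero_iff_ker_ne_bot, Submodule.ne_bot_iff]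
  exact ⟨w, by simpa using hw0, hw⟩

open MeasureTheory in
theorem exists_generic_target {d : ℕ} {f : MvPolynomial (Fin (n + 1)) ℂ} (hf : f.IsHomogeneous d)
    (hd : 2 < d) (h : HasGradDegree f 1) {S : Set (Fin (n + 1) → ℂ)} (hS : S.Finite)
    (hS0 : 0 ∉ S) :
    ∃ v q : Fin (n + 1) → ℂ, v ≠ 0 ∧ q ≠ 0 ∧ eval q f ≠ 0 ∧ gradMap f q = v ∧
      (∀ x (c : ℂ), c ≠ 0 → gradMap f x = c • v → ∃ b : ℂ, x = b • q) ∧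
      (∀ w, gradFDeriv f q w = 0 → w = 0) ∧ ∀ p ∈ S, ∑ i, p i * v i ≠ 0 := by
  obtain ⟨U, hU, hfib⟩ := h
  obtain ⟨⟨u₀, hu₀⟩, t, m, ht, ht0, htU⟩ := exists_homogeneous_of_isZariskiOpenDense hU
  have hne : ∀ u ∈ U, ∃ x, gradFiber f u = {x} := fun u hu => Set.ncard_eq_one.1 (hfib u hu).2
  have hf0 : f ≠ 0 := by
    rintro rfl
    obtain ⟨x, hx⟩ := hne u₀ hu₀
    have : x ∈ gradFiber 0 u₀ := hx ▸ rfl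
    exact this.1 (by simp)
  have hlin : ∀ p ∈ S, volume {v : Fin (n + 1) → ℂ | eval v (∑ i, C (p i) * X i) = 0} = 0 := by
    intro p hp
    refine volume_zeros_eq_zero (isHomogeneous_linear p) fun h0 => hS0 ?_
    convert hp
    ext i
    have := congrArg (eval (Pi.single i (1 : ℂ))) h0
    simpa [Pi.single_apply] using this.symm
  have hnull : volume ({0} ∪ {v : Fin (n + 1) → ℂ | eval v t = 0} ∪
      gradMap f '' {x | eval x f = 0} ∪ gradMap f '' {x | ∃ w ≠ 0, gradFDeriv f x w = 0} ∪
      ⋃ p ∈ S, {v : Fin (n + 1) → ℂ | eval v (∑ i, C (p i) * X i) = 0}) = 0 := by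
    refine measure_union_null (measure_union_null (measure_union_null (measure_union_null
      (measure_singleton _) (volume_zeros_eq_zero ht ht0)) (volume_image_gradMap_zeros hf hf0))
      (volume_criticalValues_gradMap f)) ((measure_biUnion_null_iff hS.countable).2 hlin)
  obtain ⟨v, hv⟩ : ∃ v, v ∉ _ := (Set.ne_univ_iff_exists_notMem _).1
    fun h => NeZero.ne (volume (Set.univ : Set (Fin (n + 1) → ℂ))) (h ▸ hnull)
  simp only [Set.mem_union, not_or, Set.mem_iUnion, not_exists, Set.mem_singleton_iff] at hv
  obtain ⟨⟨⟨⟨hv0, hvt⟩, hvf⟩, hvc⟩, hvS⟩ := hv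
  have hd1 : 0 < d - 1 := by omega
  have hfx : ∀ x (c : ℂ), c ≠ 0 → gradMap f x = c • v →
      ∃ b : ℂ, b ≠ 0 ∧ gradMap f (b • x) = v ∧ eval x f ≠ 0 := by
    intro x c hc hx
    obtain ⟨b, hb⟩ := IsAlgClosed.exists_pow_nat_eq c⁻¹ hd1
    have hb0 : b ≠ 0 := by
      rintro rfl
      rw [zero_pow hd1.ne'] at hb
      exact inv_ne_zero hc hb.symm
    have hbx : gradMap f (b • x) = v := by
      rw [gradMap_smul hf, hx, hb, inv_smul_smul₀ hc]
    refine ⟨b, hb0, hbx, fun h => hvf ⟨b • x, ?_, hbx⟩⟩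
    change eval (b • x) f = 0
    rw [eval_smul_of_isHomogeneous hf, h, mul_zero]
  obtain ⟨ξ, hξ⟩ := hne _ (htU v hv0 hvt)
  have hmem : ξ ∈ gradFiber f (Projectivization.mk ℂ v hv0) := hξ ▸ rfl
  obtain ⟨-, h1, h2⟩ := hmem
  obtain ⟨c, hc⟩ := (Projectivization.mk_eq_mk_iff' ℂ _ _ h1 hv0).1 h2
  have hc0 : c ≠ 0 := by rintro rfl; exact h1 (by rw [← hc, zero_smul])
  obtain ⟨b, hb0, hb, -⟩ := hfx ξ.rep c hc0 hc.symm
  have hq0 : b • ξ.rep ≠ 0 := smul_ne_zero hb0 ξ.rep_nonzero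
  refine ⟨v, b • ξ.rep, hv0, hq0, fun h => hvf ⟨_, h, hb⟩, hb, ?_, ?_, ?_⟩
  · intro x c hc hx
    by_cases hx0 : x = 0
    · exact ⟨0, by rw [hx0, zero_smul]⟩
    obtain ⟨-, -, -, hfx0⟩ := hfx x c hc hx
    obtain ⟨a, ha, hrep⟩ := smul_rep_eq hx0
    have hgv : gradVec f (Projectivization.mk ℂ x hx0) = (a ^ (d - 1) * c) • v := by
      change gradMap f (Projectivization.mk ℂ x hx0).rep = _
      rw [hrep, gradMap_smul hf, hx, smul_smul]
    have hxf : Projectivization.mk ℂ x hx0 ∈ gradFiber f (Projectivization.mk ℂ v hv0) := by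
      refine ⟨fun h => hfx0 ((eval_rep_mk_eq_zero_iff hf hx0).1 h), ?_, ?_⟩
      · rw [hgv]; exact smul_ne_zero (mul_ne_zero (pow_ne_zero _ ha) hc) hv0
      · rw [Projectivization.mk_eq_mk_iff']
        exact ⟨_, hgv.symm⟩
    rw [hξ, Set.mem_singleton_iff, ← ξ.mk_rep, Projectivization.mk_eq_mk_iff'] at hxf
    obtain ⟨r, hr⟩ := hxf
    exact ⟨r * b⁻¹, by rw [smul_smul, inv_mul_cancel_right₀ hb0, hr]⟩
  · intro w hw
    by_contra hw0
    exact hvc ⟨_, ⟨w, hw0, hw⟩, hb⟩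
  · intro p hp h
    refine hvS p hp ?_
    simpa using h

end GenericTarget

section Jets

open Filter Topology Asymptotics

variable {τ : Type*}

lemma isBigO_eval_one (p : τ → ℂ) (P : MvPolynomial τ ℂ) :
    (fun x => eval x P) =O[𝓝 p] fun _ => (1 : ℝ) :=
  (MvPolynomial.continuous_eval P).continuousAt.isBigO_one ℝ

lemma exists_radial_primitive (p : τ → ℂ) (P : MvPolynomial τ ℂ) :
    ∃ R : MvPolynomial τ ℂ, ∀ (z : τ → ℂ) (t : ℝ),
      HasDerivAt (fun t : ℝ => (t : ℂ) * eval (p + (t : ℂ) • z) R) (eval (p + (t : ℂ) • z) P) t := by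
  have key : ∀ P : MvPolynomial τ ℂ, ∃ R : MvPolynomial τ ℂ, ∀ (z : τ → ℂ) (t : ℝ),
      HasDerivAt (fun t : ℝ => (t : ℂ) * eval ((t : ℂ) • z) R) (eval ((t : ℂ) • z) P) t := by
    intro P
    induction P using MvPolynomial.monomial_add_induction_on with
    | C a => exact ⟨C a, fun z t => by simpa using (Complex.ofRealCLM.hasDerivAt (x := t)).mul_const a⟩
    | monomial_add α a f _ _ hR =>
      obtain ⟨R, hR⟩ := hR
      refine ⟨monomial α (a / (α.degree + 1)) + R, fun z t => ?_⟩
      simp only [map_add, mul_add]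
      refine HasDerivAt.add ?_ (hR z t)
      have hm : ∀ b : ℂ, (monomial α b : MvPolynomial τ ℂ).IsHomogeneous α.degree :=
        fun b => isHomogeneous_monomial b rfl
      simp only [eval_smul_of_isHomogeneous (hm _)]
      have h1 : HasDerivAt (fun t : ℝ => (t : ℂ) ^ (α.degree + 1))
          ((α.degree + 1 : ℕ) * (t : ℂ) ^ α.degree) t := by
        simpa using (Complex.ofRealCLM.hasDerivAt (x := t)).fun_pow (α.degree + 1)
      have h2 := h1.mul_const (eval z (monomial α (a / (α.degree + 1))))
      have h3 : ((α.degree : ℂ) + 1) ≠ 0 := by exact_mod_cast (α.degree).succ_ne_zero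
      have h4 : (((α.degree + 1 : ℕ) : ℂ) * (t : ℂ) ^ α.degree) *
          eval z (monomial α (a / (α.degree + 1))) = (t : ℂ) ^ α.degree * eval z (monomial α a) := by
        rw [eval_monomial, eval_monomial]
        push_cast
        field_simp
      rw [h4] at h2
      refine h2.congr_of_eventuallyEq (Eventually.of_forall fun t => ?_)
      dsimp only
      ring
  obtain ⟨R, hR⟩ := key (aeval (fun i => X i + C (p i)) P)
  refine ⟨aeval (fun i => X i - C (p i)) R, fun z t => ?_⟩
  have := hR z t
  simp only [eval_aeval] at this ⊢
  convert this using 1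
  · ext t
    congr 3
    ext i; simp
  · congr 2
    ext i; simp [add_comm]

variable [Fintype τ]

/-- The polynomial `P` agrees with `h` to order `K` at `p`. -/
def IsJet (K : ℕ) (p : τ → ℂ) (h : (τ → ℂ) → ℂ) (P : MvPolynomial τ ℂ) : Prop :=
  (fun x => h x - eval x P) =O[𝓝 p] fun x => ‖x - p‖ ^ K

lemma isJet_eval (K : ℕ) (p : τ → ℂ) (P : MvPolynomial τ ℂ) : IsJet K p (fun x => eval x P) P := by
  simp only [IsJet, sub_self]
  exact isBigO_zero _ _

lemma IsJet.isBigO_one {K : ℕ} {p : τ → ℂ} {h : (τ → ℂ) → ℂ} {P : MvPolynomial τ ℂ}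
    (hP : IsJet K p h P) : h =O[𝓝 p] fun _ => (1 : ℝ) := by
  have h1 : (fun x : τ → ℂ => ‖x - p‖ ^ K) =O[𝓝 p] fun _ => (1 : ℝ) :=
    (show ContinuousAt (fun x : τ → ℂ => ‖x - p‖ ^ K) p by fun_prop).isBigO_one ℝ
  simpa using (hP.trans h1).add (isBigO_eval_one p P)

lemma IsJet.add {K : ℕ} {p : τ → ℂ} {h k : (τ → ℂ) → ℂ} {P Q : MvPolynomial τ ℂ}
    (hP : IsJet K p h P) (hQ : IsJet K p k Q) : IsJet K p (fun x => h x + k x) (P + Q) := by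
  refine (IsBigO.add hP hQ).congr_left fun x => ?_
  simp only [map_add]; ring

lemma IsJet.mul {K : ℕ} {p : τ → ℂ} {h k : (τ → ℂ) → ℂ} {P Q : MvPolynomial τ ℂ}
    (hP : IsJet K p h P) (hQ : IsJet K p k Q) : IsJet K p (fun x => h x * k x) (P * Q) := by
  have h1 := IsBigO.mul hP hQ.isBigO_one
  have h2 := IsBigO.mul (isBigO_eval_one p P) hQ
  simp only [mul_one, one_mul] at h1 h2
  refine (h1.add h2).congr_left fun x => ?_
  simp only [map_mul]; ring

lemma IsJet.sum {ι : Type*} {s : Finset ι} {K : ℕ} {p : τ → ℂ} {h : ι → (τ → ℂ) → ℂ}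
    {P : ι → MvPolynomial τ ℂ} (hP : ∀ i ∈ s, IsJet K p (h i) (P i)) :
    IsJet K p (fun x => ∑ i ∈ s, h i x) (∑ i ∈ s, P i) := by
  refine (IsBigO.fun_sum hP).congr_left fun x => ?_
  simp

/-- A function whose partial derivatives have jets of order `K` has jets of order `K + 1`. -/
lemma exists_isJet_succ {K : ℕ} {p : τ → ℂ} {h : (τ → ℂ) → ℂ} {h' : τ → (τ → ℂ) → ℂ}
    (hh : ∀ᶠ x in 𝓝 p, HasFDerivAt h (∑ j, h' j x • (ContinuousLinearMap.proj j : (τ → ℂ) →L[ℂ] ℂ)) x)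
    {P : τ → MvPolynomial τ ℂ} (hP : ∀ j, IsJet K p (h' j) (P j)) :
    ∃ Q, IsJet (K + 1) p h Q := by
  choose R hR using fun j => exists_radial_primitive p (P j)
  refine ⟨C (h p) + ∑ j, (X j - C (p j)) * R j, ?_⟩
  choose c hc0 hc using fun j => (hP j).exists_nonneg
  replace hc := fun j => (hc j).bound
  refine IsBigO.of_bound (∑ j, c j) ?_
  obtain ⟨ε, hε, hball⟩ := Metric.eventually_nhds_iff_ball.1
    (hh.and (eventually_all.2 hc))
  filter_upwards [Metric.ball_mem_nhds p hε] with x hx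
  set z := x - p with hz
  have hseg : ∀ t ∈ Set.Icc (0 : ℝ) 1, p + (t : ℂ) • z ∈ Metric.ball p ε := by
    intro t ht
    rw [mem_ball_iff_norm, add_sub_cancel_left, norm_smul, Complex.norm_real, Real.norm_eq_abs,
      abs_of_nonneg ht.1]
    have := mem_ball_iff_norm.1 hx
    nlinarith [norm_nonneg z, ht.2]
  let φ : ℝ → ℂ := fun t => h (p + (t : ℂ) • z) - ∑ j, z j * (t * eval (p + (t : ℂ) • z) (R j))
  have hφ : ∀ t ∈ Set.Icc (0 : ℝ) 1, HasDerivAt φ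
      (∑ j, z j * (h' j (p + (t : ℂ) • z) - eval (p + (t : ℂ) • z) (P j))) t := by
    intro t ht
    have h1 : HasDerivAt (fun t : ℝ => p + (t : ℂ) • z) z t := by
      simpa using ((Complex.ofRealCLM.hasDerivAt (x := t)).smul_const z).const_add p
    have h2 := ((hball _ (hseg t ht)).1.restrictScalars ℝ).comp_hasDerivAt t h1
    have h3 : HasDerivAt (fun t : ℝ => ∑ j, z j * (t * eval (p + (t : ℂ) • z) (R j)))
        (∑ j, z j * eval (p + (t : ℂ) • z) (P j)) t :=
      HasDerivAt.fun_sum fun j _ => (hR j z t).const_mul (z j)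
    refine (h2.sub h3).congr_deriv ?_
    simp [mul_sub, Finset.sum_sub_distrib, mul_comm]
  have hmv := norm_image_sub_le_of_norm_deriv_le_segment_01' (f := φ)
    (C := (∑ j, c j) * ‖z‖ ^ (K + 1)) (fun t ht => (hφ t ht).hasDerivWithinAt) (by
      intro t ht
      have ht' : t ∈ Set.Icc (0 : ℝ) 1 := ⟨ht.1, ht.2.le⟩
      rw [Finset.sum_mul]
      refine (norm_sum_le _ _).trans (Finset.sum_le_sum fun j _ => ?_)
      have h1 := (hball _ (hseg t ht')).2 j
      rw [add_sub_cancel_left, norm_pow, norm_norm, norm_smul, Complex.norm_real, Real.norm_eq_abs,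
        abs_of_nonneg ht.1] at h1
      rw [norm_mul]
      have h2 : t ^ K ≤ 1 := pow_le_one₀ ht.1 ht.2.le
      have h3 : c j * (t * ‖z‖) ^ K ≤ c j * ‖z‖ ^ K := by
        rw [mul_pow]
        exact mul_le_mul_of_nonneg_left
          (mul_le_of_le_one_left (by positivity) h2) (hc0 j)
      calc _ ≤ ‖z‖ * (c j * ‖z‖ ^ K) :=
            mul_le_mul (norm_le_pi_norm z j) (h1.trans h3) (norm_nonneg _) (norm_nonneg _)
        _ = _ := by ring)
  rw [norm_pow, norm_norm]
  refine le_trans (le_of_eq ?_) hmv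
  congr 1
  simp [φ, hz]
  ring

end Jets

section Descent

open Filter Topology Asymptotics

variable {τ : Type*} [Fintype τ]

lemma exists_isJet_of_class {p : τ → ℂ} {F : Set ((τ → ℂ) → ℂ)}
    (hO : ∀ h ∈ F, h =O[𝓝 p] fun _ => (1 : ℝ))
    (hd : ∀ h ∈ F, ∃ h' : τ → (τ → ℂ) → ℂ, (∀ j, h' j ∈ F) ∧ ∀ᶠ x in 𝓝 p,
      HasFDerivAt h (∑ j, h' j x • (ContinuousLinearMap.proj j : (τ → ℂ) →L[ℂ] ℂ)) x)
    (K : ℕ) {h : (τ → ℂ) → ℂ} (hh : h ∈ F) : ∃ P, IsJet K p h P := by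
  induction K generalizing h with
  | zero => exact ⟨0, by simpa [IsJet] using hO h hh⟩
  | succ K ih =>
    obtain ⟨h', h1, h2⟩ := hd h hh
    choose P hP using fun j => ih (h1 j)
    exact exists_isJet_succ h2 hP

lemma eq_sum_smul_proj [DecidableEq τ] (L : (τ → ℂ) →L[ℂ] ℂ) :
    L = ∑ j, L (Pi.single j 1) • (ContinuousLinearMap.proj j : (τ → ℂ) →L[ℂ] ℂ) := by
  ext w
  conv_lhs => rw [← Finset.univ_sum_single w]
  simp only [map_sum, sum_apply, smul_apply,
    ContinuousLinearMap.proj_apply, smul_eq_mul]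
  refine Finset.sum_congr rfl fun j _ => ?_
  have : (Pi.single j (w j) : τ → ℂ) = w j • Pi.single j 1 := by
    rw [← Pi.single_smul, smul_eq_mul, mul_one]
  rw [this, map_smul, smul_eq_mul, mul_comm]

lemma AnalyticAt.exists_isJet {p : τ → ℂ} {h : (τ → ℂ) → ℂ} (hh : AnalyticAt ℂ h p) (K : ℕ) :
    ∃ P, IsJet K p h P := by
  classical
  refine exists_isJet_of_class (F := {h | AnalyticAt ℂ h p})
    (fun h hh => hh.continuousAt.isBigO_one ℝ) (fun h hh => ?_) K hh
  refine ⟨fun j x => fderiv ℂ h x (Pi.single j 1), fun j => ?_, ?_⟩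
  · exact ((ContinuousLinearMap.apply ℂ ℂ (Pi.single j 1)).analyticAt _).comp hh.fderiv
  · filter_upwards [hh.eventually_analyticAt] with x hx
    rw [← eq_sum_smul_proj]
    exact hx.differentiableAt.hasFDerivAt

lemma Polynomial.coeff_eq_zero_of_isBigO {q : Polynomial ℂ} {K : ℕ}
    (hq : (fun t : ℂ => q.eval t) =O[𝓝 0] fun t => ‖t‖ ^ K) {m : ℕ} (hm : m < K) :
    q.coeff m = 0 := by
  by_contra hne
  have hq0 : q ≠ 0 := by rintro rfl; simp at hne
  obtain ⟨r, hr, hr0⟩ := Polynomial.exists_eq_pow_rootMultiplicity_mul_and_not_dvd q hq0 0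
  set k := q.rootMultiplicity 0
  rw [Polynomial.C_0, sub_zero] at hr hr0
  have hk : k ≤ m := by
    by_contra! H
    exact hne ((Polynomial.X_pow_dvd_iff.1 ⟨r, hr⟩) m H)
  obtain ⟨C, hC⟩ := hq.bound
  have hr1 : r.eval 0 = 0 := by
    have h1 : Tendsto (fun t : ℂ => ‖r.eval t‖) (𝓝[≠] 0) (𝓝 ‖r.eval 0‖) :=
      (r.continuous.norm.tendsto 0).mono_left nhdsWithin_le_nhds
    have h2 : Tendsto (fun t : ℂ => C * ‖t‖ ^ (K - k)) (𝓝[≠] 0) (𝓝 0) := by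
      have : Continuous fun t : ℂ => C * ‖t‖ ^ (K - k) := by fun_prop
      have := (this.tendsto 0).mono_left (nhdsWithin_le_nhds (s := {(0 : ℂ)}ᶜ))
      simpa [show K - k ≠ 0 by omega] using this
    have h3 := le_of_tendsto_of_tendsto h1 h2 (by
      filter_upwards [nhdsWithin_le_nhds hC, self_mem_nhdsWithin] with t ht ht0
      have ht0 : t ≠ 0 := ht0
      rw [hr, Polynomial.eval_mul, Polynomial.eval_pow, Polynomial.eval_X, norm_mul, norm_pow,
        norm_pow, norm_norm, show K = k + (K - k) by omega, pow_add] at ht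
      have h4 : 0 < ‖t‖ ^ k := by positivity
      refine le_of_mul_le_mul_left (ht.trans (le_of_eq ?_)) h4
      ring)
    exact norm_le_zero_iff.1 h3
  exact hr0 (Polynomial.X_dvd_iff.2 (by rwa [Polynomial.coeff_zero_eq_eval_zero]))

lemma mem_pow_idealOfVars_of_isBigO {P : MvPolynomial τ ℂ} {K : ℕ}
    (hP : (fun x => eval x P) =O[𝓝 0] fun x => ‖x‖ ^ K) : P ∈ idealOfVars τ ℂ ^ K := by
  have hcomp : ∀ m < K, homogeneousComponent m P = 0 := by
    intro m hm
    refine MvPolynomial.funext fun x => ?_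
    rw [map_zero]
    let q : Polynomial ℂ := ∑ i ∈ Finset.range (P.totalDegree + 1),
      Polynomial.monomial i (eval x (homogeneousComponent i P))
    have hq : ∀ t, q.eval t = eval (t • x) P := by
      intro t
      conv_rhs => rw [← sum_homogeneousComponent P]
      simp only [q, Polynomial.eval_finsetSum, Polynomial.eval_monomial, map_sum]
      refine Finset.sum_congr rfl fun i _ => ?_
      rw [eval_smul_of_isHomogeneous (homogeneousComponent_isHomogeneous i P), mul_comm]
    have hO : (fun t : ℂ => q.eval t) =O[𝓝 0] fun t => ‖t‖ ^ K := by
      simp only [hq]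
      have h1 : Tendsto (fun t : ℂ => t • x) (𝓝 0) (𝓝 0) := by
        have : Continuous fun t : ℂ => t • x := by fun_prop
        simpa using this.tendsto 0
      refine (hP.comp_tendsto h1).trans (IsBigO.of_bound (‖x‖ ^ K) (Eventually.of_forall fun t => ?_))
      simp [norm_smul, mul_pow, mul_comm]
    have h2 := Polynomial.coeff_eq_zero_of_isBigO hO hm
    simp only [q, Polynomial.finsetSum_coeff, Polynomial.coeff_monomial] at h2
    by_cases hmP : m ∈ Finset.range (P.totalDegree + 1)
    · simpa [hmP] using h2
    · rw [homogeneousComponent_eq_zero _ _ (by simpa using hmP), map_zero]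
  rw [mem_pow_idealOfVars_iff']
  intro α hα
  have h1 := congrArg (coeff α) (hcomp _ hα)
  rwa [coeff_homogeneousComponent, if_pos rfl, coeff_zero] at h1

lemma mem_span_pow_of_isBigO {p : τ → ℂ} {P : MvPolynomial τ ℂ} {K : ℕ}
    (hP : (fun x => eval x P) =O[𝓝 p] fun x => ‖x - p‖ ^ K) :
    P ∈ Ideal.span (Set.range fun i => (X i - C (p i) : MvPolynomial τ ℂ)) ^ K := by
  have h1 : aeval (fun i => X i + C (p i)) P ∈ idealOfVars τ ℂ ^ K := by
    refine mem_pow_idealOfVars_of_isBigO ?_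
    have ht : Tendsto (fun x : τ → ℂ => x + p) (𝓝 0) (𝓝 p) := by
      have : Continuous fun x : τ → ℂ => x + p := by fun_prop
      simpa using this.tendsto 0
    refine (hP.comp_tendsto ht).congr (fun x => ?_) (fun x => ?_)
    · rw [eval_aeval]
      simp only [Function.comp, map_add, eval_X, eval_C]
      rfl
    · simp
  have h2 := Ideal.mem_map_of_mem
    (aeval (fun i => (X i - C (p i) : MvPolynomial τ ℂ)) : MvPolynomial τ ℂ →ₐ[ℂ] _) h1
  rw [Ideal.map_pow, idealOfVars, Ideal.map_span, ← Set.range_comp] at h2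
  convert h2 using 1
  · congr 3
    ext1 i
    simp
  · refine AlgHom.congr_fun (?_ : AlgHom.id ℂ (MvPolynomial τ ℂ) =
      (aeval fun i => X i - C (p i)).comp (aeval fun i => X i + C (p i))) P
    ext1 i
    simp

theorem exists_mul_mem_of_jets {ι : Type*} [Fintype ι] {p : τ → ℂ} {g : ι → MvPolynomial τ ℂ}
    {g₀ : MvPolynomial τ ℂ} {ξ : ι → (τ → ℂ) → ℂ} {ξ₀ : (τ → ℂ) → ℂ}
    (hξ : ∀ j K, ∃ P, IsJet K p (ξ j) P) (hξ₀ : ∀ K, ∃ P, IsJet K p ξ₀ P)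
    (hrel : ∀ᶠ x in 𝓝 p, ∑ j, ξ j x * eval x (g j) + ξ₀ x * eval x g₀ = 0) (h0 : ξ₀ p ≠ 0) :
    ∃ u, eval p u ≠ 0 ∧ u * g₀ ∈ Ideal.span (Set.range g) := by
  set J := Ideal.span (Set.range fun i => (X i - C (p i) : MvPolynomial τ ℂ)) with hJ
  have hJp : ∀ u ∈ J, eval p u = 0 := by
    intro u hu
    have : J ≤ RingHom.ker (eval p) := by
      rw [hJ, Ideal.span_le]
      rintro _ ⟨i, rfl⟩
      simp
    exact this hu
  have hmem : ∀ N : ℕ, g₀ ∈ Ideal.span (Set.range g) ⊔ J ^ (N + 1) := by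
    intro N
    choose P hP using fun j => hξ j (N + 1)
    obtain ⟨P₀, hP₀⟩ := hξ₀ (N + 1)
    have hc : eval p P₀ = ξ₀ p := by
      obtain ⟨C, hC⟩ := hP₀.bound
      have := hC.self_of_nhds
      simp only [sub_self, norm_zero, ne_eq, Nat.succ_ne_zero, not_false_eq_true, zero_pow,
        mul_zero, norm_le_zero_iff] at this
      exact (sub_eq_zero.1 this).symm
    have hQ : ∑ j, P j * g j + P₀ * g₀ ∈ J ^ (N + 1) := by
      refine mem_span_pow_of_isBigO ?_
      have h1 := (IsJet.sum (s := Finset.univ) fun j _ => (hP j).mul (isJet_eval (N + 1) p (g j))).add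
        (hP₀.mul (isJet_eval (N + 1) p g₀))
      refine (IsBigO.congr' h1.neg_left ?_ EventuallyEq.rfl)
      filter_upwards [hrel] with x hx
      rw [hx]; ring
    set c : MvPolynomial τ ℂ := C (ξ₀ p) with hcdef
    have h1 : c - P₀ ∈ J := by
      have := sub_aeval_mem (J := J) (s := fun i => C (p i))
        (fun i => Ideal.subset_span ⟨i, rfl⟩) P₀
      have h2 : aeval (fun i => (C (p i) : MvPolynomial τ ℂ)) P₀ = c := by
        rw [hcdef, ← hc]
        have := aeval_algebraMap_apply (MvPolynomial τ ℂ) p P₀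
        simpa [aeval_eq_eval, Function.comp_def] using this
      rw [h2] at this
      rw [← neg_sub]; exact J.neg_mem this
    obtain ⟨s, hs⟩ := sub_dvd_pow_sub_pow c (c - P₀) (N + 1)
    rw [sub_sub_cancel] at hs
    have h3 : c ^ (N + 1) * g₀ ∈ Ideal.span (Set.range g) ⊔ J ^ (N + 1) := by
      have h4 : c ^ (N + 1) * g₀ = (-(s * ∑ j, P j * g j)) +
          (s * (∑ j, P j * g j + P₀ * g₀) + (c - P₀) ^ (N + 1) * g₀) := by
        linear_combination hs * g₀
      rw [h4]
      refine Submodule.add_mem_sup (neg_mem (Ideal.mul_mem_left _ _ (Ideal.sum_mem _ fun j _ =>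
        Ideal.mul_mem_left _ _ (Ideal.subset_span ⟨j, rfl⟩)))) (add_mem (Ideal.mul_mem_left _ _ hQ)
        (Ideal.mul_mem_right _ _ (Ideal.pow_mem_pow h1 _)))
    have h5 := Ideal.mul_mem_left _ (C ((ξ₀ p)⁻¹ ^ (N + 1))) h3
    rwa [← mul_assoc, hcdef, ← C_pow, ← C_mul, ← mul_pow, inv_mul_cancel₀ h0, one_pow, C_1,
      one_mul] at h5
  have hinf : Submodule.mkQ (Ideal.span (Set.range g)) g₀ ∈
      (⨅ i : ℕ, J ^ i • ⊤ : Submodule (MvPolynomial τ ℂ) (_ ⧸ Ideal.span (Set.range g))) := by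
    rw [Submodule.mem_iInf]
    intro i
    obtain ⟨a, ha, b, hb, hab⟩ := Submodule.mem_sup.1 (hmem i)
    have h1 : Submodule.mkQ (Ideal.span (Set.range g)) g₀ =
        b • Submodule.mkQ (Ideal.span (Set.range g)) 1 := by
      rw [← map_smul, smul_eq_mul, mul_one, ← hab, map_add]
      rw [Submodule.mkQ_apply, (Submodule.Quotient.mk_eq_zero _).2 ha, zero_add]
    rw [h1]
    exact Submodule.smul_mem_smul (Ideal.pow_le_pow_right i.le_succ hb) trivial
  obtain ⟨r, hr⟩ := (Ideal.mem_iInf_smul_pow_eq_bot_iff J _).1 hinf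
  refine ⟨1 - r, by simp [hJp r r.2], ?_⟩
  rw [← map_smul] at hr
  have := sub_eq_zero.2 hr.symm
  rw [← map_sub] at this
  rw [Submodule.mkQ_apply, Submodule.Quotient.mk_eq_zero] at this
  simpa [sub_mul] using this

end Descent

section Division

open Filter Topology Asymptotics Metric

lemma HasStrictFDerivAt.isBigO_of_zeros {E : Type*} [NormedAddCommGroup E] [NormedSpace ℂ E]
    [CompleteSpace E] {f F : E → ℂ} {f' F' : E →L[ℂ] ℂ} {x : E} (hf : HasStrictFDerivAt f f' x)
    (hf' : f' ≠ 0) (hfx : f x = 0) (hF : HasStrictFDerivAt F F' x)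
    (hz : ∀ᶠ y in 𝓝 x, f y = 0 → F y = 0) : F =O[𝓝 x] f := by
  have hsurj : f'.range = ⊤ := by
    rw [LinearMap.range_eq_top]
    exact LinearMap.surjective (f := (f' : E →ₗ[ℂ] ℂ)) (fun h => hf' (by ext w; exact LinearMap.congr_fun h w))
  set R := f'.nonlinearRightInverseOfSurjective hsurj with hR
  have hRpos : 0 < R.nnnorm := f'.nonlinearRightInverseOfSurjective_nnnorm_pos hsurj
  set c : NNReal := R.nnnorm⁻¹ / 2 with hc
  have hcpos : 0 < c := half_pos (inv_pos.2 hRpos)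
  obtain ⟨s, hs, happ⟩ := hf.approximates_deriv_on_nhds (c := c) (Or.inr hcpos)
  obtain ⟨L, u, hu, hLip⟩ := hF.exists_lipschitzOnWith
  obtain ⟨ε, hε, hball⟩ := nhds_basis_closedBall.mem_iff.1 (inter_mem (inter_mem hs hu) hz)
  have hcR : (c : ℝ) = ((R.nnnorm : ℝ))⁻¹ - c := by
    rw [hc]; push_cast; ring
  refine IsBigO.of_bound (L * (c : ℝ)⁻¹) ?_
  have hcont : Tendsto (fun y => ‖f y‖ / c) (𝓝 x) (𝓝 0) := by
    have := (hf.continuousAt.norm.div_const (c : ℝ))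
    simpa [ContinuousAt, hfx] using this
  filter_upwards [closedBall_mem_nhds x (half_pos hε), hcont (Iic_mem_nhds (half_pos hε))]
    with y hy hfy
  have hsub : closedBall y (‖f y‖ / c) ⊆ closedBall x ε := by
    refine closedBall_subset_closedBall' ?_
    have h1 : ‖f y‖ / c ≤ ε / 2 := hfy
    have h2 : dist y x ≤ ε / 2 := hy
    linarith
  have h3 := happ.surjOn_closedBall_of_nonlinearRightInverse R (ε := ‖f y‖ / c) (b := y)
    (by positivity) (hsub.trans (hball.trans fun _ h => h.1.1))
  have h4 : (0 : ℂ) ∈ closedBall (f y) (((R.nnnorm : ℝ)⁻¹ - c) * (‖f y‖ / c)) := by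
    rw [← hcR, mul_div_cancel₀ _ (by exact_mod_cast hcpos.ne'), mem_closedBall, dist_zero_left]
  obtain ⟨y', hy', hfy'⟩ := h3 h4
  have h5 : F y' = 0 := (hball (hsub hy')).2 hfy'
  have h6 := hLip.dist_le_mul y (hball (hsub (mem_closedBall_self (by positivity)))).1.2 y'
    (hball (hsub hy')).1.2
  rw [h5, dist_zero_right] at h6
  refine h6.trans ?_
  rw [mul_assoc]
  refine mul_le_mul_of_nonneg_left ?_ L.2
  rw [dist_comm]
  exact (mem_closedBall.1 hy').trans (le_of_eq (by rw [div_eq_inv_mul]))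

open Real in
lemma circleAverage_eq_of_removable {G : ℂ → ℂ} {r : ℝ} (hr : 0 < r) {S : Set ℂ} (hS : S.Finite)
    (hd : ∀ t ∈ closedBall (0 : ℂ) r, t ∉ S → ∀ᶠ s in 𝓝 t, DifferentiableAt ℂ G s)
    (hb : ∀ t ∈ closedBall (0 : ℂ) r, t ∈ S → G =O[𝓝[≠] t] fun _ => (1 : ℝ))
    (hSr : ∀ t ∈ S, ‖t‖ ≠ r) (h0 : 0 ∉ S) : circleAverage G 0 r = G 0 := by
  set H : ℂ → ℂ := fun t => limUnder (𝓝[≠] t) G with hH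
  have hHG : ∀ t, DifferentiableAt ℂ G t → H t = G t := fun t ht =>
    (ht.continuousAt.tendsto.mono_left nhdsWithin_le_nhds).limUnder_eq
  have hHd : ∀ t ∈ closedBall (0 : ℂ) r, t ∉ S → DifferentiableAt ℂ H t := by
    intro t ht htS
    refine (hd t ht htS).self_of_nhds.congr_of_eventuallyEq ?_
    filter_upwards [hd t ht htS] with s hs using hHG s hs
  have hHc : ContinuousOn H (closedBall 0 r) := by
    intro t ht
    refine ContinuousAt.continuousWithinAt ?_
    by_cases htS : t ∈ S
    · have htr : t ∈ ball (0 : ℂ) r := by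
        rw [mem_ball_zero_iff]
        exact lt_of_le_of_ne (mem_closedBall_zero_iff.1 ht) (hSr t htS)
      have hev : ∀ᶠ s in 𝓝[≠] t, DifferentiableAt ℂ G s := by
        have h1 : (S \ {t})ᶜ ∈ 𝓝 t :=
          (hS.subset Set.sdiff_subset).isClosed.isOpen_compl.mem_nhds (by simp)
        filter_upwards [nhdsWithin_le_nhds h1, self_mem_nhdsWithin,
          nhdsWithin_le_nhds (isOpen_ball.mem_nhds htr)] with s hs hst hsr
        exact (hd s (ball_subset_closedBall hsr) fun hsS => hs ⟨hsS, hst⟩).self_of_nhds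
      have h2 := Complex.tendsto_limUnder_of_differentiable_on_punctured_nhds_of_bounded_under hev
        (by
          obtain ⟨C, hC⟩ := (hb t ht htS).bound
          refine ⟨C + ‖G t‖, ?_⟩
          rw [eventually_map]
          filter_upwards [hC] with s hs
          simp only [norm_one, mul_one] at hs
          exact (norm_sub_le _ _).trans (by gcongr))
      rw [← continuousWithinAt_compl_self]
      exact h2.congr' (by filter_upwards [hev] with s hs using (hHG s hs).symm)
    · exact (hHd t ht htS).continuousAt
  have h0b : (0 : ℂ) ∈ closedBall (0 : ℂ) r := mem_closedBall_self hr.le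
  have hmain := circleAverage_of_differentiable_on_off_countable (f := H) (c := 0) (R := r)
    hS.countable (by rwa [abs_of_pos hr]) (fun t ht => by
      rw [abs_of_pos hr] at ht
      exact hHd t (ball_subset_closedBall ht.1) ht.2)
  rw [hHG 0 (hd 0 h0b h0).self_of_nhds] at hmain
  rw [← hmain]
  refine circleAverage_congr_sphere fun t ht => ?_
  rw [abs_of_pos hr] at ht
  exact (hHG t (hd t (sphere_subset_closedBall ht)
    fun hS => hSr t hS (mem_sphere_zero_iff_norm.1 ht)).self_of_nhds).symm

open Real MeasureTheory in
lemma hasFDerivAt_circleAverage {τ : Type*} [Fintype τ] [DecidableEq τ] {Φ : (τ → ℂ) → ℂ}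
    {Ω : Set (τ → ℂ)} (hΩ : IsOpen Ω) (hΦ : AnalyticOnNhd ℂ Φ Ω) {e z : τ → ℂ} {r : ℝ}
    (hz : ∀ t ∈ sphere (0 : ℂ) |r|, z + t • e ∈ Ω) :
    HasFDerivAt (fun z => circleAverage (fun t => Φ (z + t • e)) 0 r)
      (∑ j, circleAverage (fun t => fderiv ℂ Φ (z + t • e) (Pi.single j 1)) 0 r •
        (ContinuousLinearMap.proj j : (τ → ℂ) →L[ℂ] ℂ)) z := by
  set K : Set (τ → ℂ) := (fun t : ℂ => z + t • e) '' sphere (0 : ℂ) |r| with hK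
  have hKc : IsCompact K := (isCompact_sphere _ _).image (by fun_prop)
  obtain ⟨δ, hδ, hKδ⟩ := hKc.exists_cthickening_subset_open hΩ (by rintro _ ⟨t, ht, rfl⟩; exact hz t ht)
  have hKδc : IsCompact (cthickening δ K) := hKc.cthickening
  have hdc : ContinuousOn (fderiv ℂ Φ) Ω := hΦ.fderiv.continuousOn
  obtain ⟨C, hC⟩ := hKδc.exists_bound_of_continuousOn (hdc.mono hKδ)
  have hmem : ∀ z' ∈ ball z δ, ∀ θ : ℝ, z' + circleMap 0 r θ • e ∈ cthickening δ K := by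
    intro z' hz' θ
    refine mem_cthickening_of_dist_le _ (z + circleMap 0 r θ • e) _ _
      ⟨_, circleMap_mem_sphere' 0 r θ, rfl⟩ ?_
    rw [dist_add_right]
    exact (mem_ball.1 hz').le
  have hcirc : ∀ z' : τ → ℂ, Continuous fun θ : ℝ => z' + circleMap 0 r θ • e := by
    intro z'; fun_prop
  have hcont : ∀ z' ∈ ball z δ, Continuous fun θ : ℝ => Φ (z' + circleMap 0 r θ • e) :=
    fun z' hz' => hΦ.continuousOn.comp_continuous (hcirc z') fun θ => hKδ (hmem z' hz' θ)
  have hcont' : Continuous fun θ : ℝ => fderiv ℂ Φ (z + circleMap 0 r θ • e) :=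
    hdc.comp_continuous (hcirc z) fun θ => hKδ (hmem z (mem_ball_self hδ) θ)
  have h1 := intervalIntegral.hasFDerivAt_integral_of_dominated_of_fderiv_le (𝕜 := ℂ) (μ := volume)
    (a := 0) (b := 2 * π) (s := ball z δ) (x₀ := z) (bound := fun _ => C)
    (F := fun z' θ => Φ (z' + circleMap 0 r θ • e))
    (F' := fun z' θ => fderiv ℂ Φ (z' + circleMap 0 r θ • e)) (ball_mem_nhds z hδ)
    (by filter_upwards [ball_mem_nhds z hδ] with z' hz' using (hcont z' hz').aestronglyMeasurable)
    ((hcont z (mem_ball_self hδ)).intervalIntegrable _ _) hcont'.aestronglyMeasurable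
    (Eventually.of_forall fun θ _ z' hz' => hC _ (hmem z' hz' θ)) intervalIntegrable_const
    (Eventually.of_forall fun θ _ z' hz' =>
      (hasFDerivAt_comp_add_right _).2 (hΦ _ (hKδ (hmem z' hz' θ))).differentiableAt.hasFDerivAt)
  have h2 := h1.const_smul ((2 * π)⁻¹ : ℝ)
  refine h2.congr_fderiv ?_
  rw [eq_sum_smul_proj (∫ θ in (0 : ℝ)..2 * π, fderiv ℂ Φ (z + circleMap 0 r θ • e)), Finset.smul_sum]
  refine Finset.sum_congr rfl fun j _ => ?_
  rw [circleAverage_def, ContinuousLinearMap.intervalIntegral_apply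
    (hcont'.intervalIntegrable _ _), smul_assoc]

lemma exists_slice {τ : Type*} (f : MvPolynomial τ ℂ) (c e : τ → ℂ) :
    ∃ q : Polynomial ℂ, ∀ t, q.eval t = eval (c + t • e) f := by
  refine ⟨aeval (fun i => Polynomial.C (c i) + Polynomial.X * Polynomial.C (e i)) f, fun t => ?_⟩
  induction f using MvPolynomial.induction_on with
  | C a => simp
  | add p q hp hq => rw [map_add, Polynomial.eval_add, hp, hq, map_add]
  | mul_X p i hp =>
    rw [map_mul, Polynomial.eval_mul, hp, aeval_X, map_mul, eval_X]
    simp [mul_comm t]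

lemma finite_zeros_slice {τ : Type*} {f : MvPolynomial τ ℂ} {c e : τ → ℂ} {t₀ : ℂ}
    (h : eval (c + t₀ • e) f ≠ 0) : {t : ℂ | eval (c + t • e) f = 0}.Finite := by
  obtain ⟨q, hq⟩ := exists_slice f c e
  have hq0 : q ≠ 0 := by
    rintro rfl
    exact h (by rw [← hq, Polynomial.eval_zero])
  refine (Polynomial.finite_setOfPred_isRoot hq0).subset fun t ht => ?_
  change q.eval t = 0
  rw [hq]; exact ht

lemma dense_compl_span_pair {τ : Type*} [Fintype τ] (hcard : 3 ≤ Fintype.card τ) (p e : τ → ℂ) :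
    Dense ((Submodule.span ℂ {p, e} : Submodule ℂ (τ → ℂ)) : Set (τ → ℂ))ᶜ := by
  rw [← interior_eq_empty_iff_dense_compl]
  by_contra h
  have h1 := Submodule.eq_top_of_nonempty_interior' _ (Set.nonempty_iff_ne_empty.2 h)
  have h2 : Module.finrank ℂ (Submodule.span ℂ {p, e} : Submodule ℂ (τ → ℂ)) ≤ 2 := by
    classical
    have := finrank_span_finset_le_card (R := ℂ) ({p, e} : Finset (τ → ℂ))
    rw [Finset.coe_pair] at this
    exact this.trans Finset.card_le_two
  rw [h1, finrank_top, Module.finrank_pi] at h2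
  omega

lemma hasStrictFDerivAt_eval {τ : Type*} [Fintype τ] (f : MvPolynomial τ ℂ) (x : τ → ℂ) :
    HasStrictFDerivAt (fun x => eval x f) (evalFDeriv f x) x := by
  have h1 : AnalyticAt ℂ (fun x : τ → ℂ => eval x f) x :=
    AnalyticOnNhd.eval_mvPolynomial f x (Set.mem_univ _)
  have h2 := h1.hasStrictFDerivAt
  rwa [(hasFDerivAt_eval f x).fderiv] at h2

/-- An analytic function vanishing on the zero set of `f` near `p` is divisible by `f` there, when
`f` is smooth at its zeros near `p` off the line through `p`: the quotient has jets of all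
orders at `p`. -/
theorem exists_quotient_isJet {τ : Type*} [Fintype τ] (hcard : 3 ≤ Fintype.card τ)
    {f : MvPolynomial τ ℂ} (hf0 : f ≠ 0) {p : τ → ℂ} {F : (τ → ℂ) → ℂ} (hF : AnalyticAt ℂ F p)
    (hz : ∀ᶠ x in 𝓝 p, eval x f = 0 → F x = 0)
    (hs : ∀ᶠ x in 𝓝 p, eval x f = 0 → (∀ i, eval x (pderiv i f) = 0) → ∃ c : ℂ, x = c • p) :
    ∃ h : (τ → ℂ) → ℂ, (∀ K, ∃ P, IsJet K p h P) ∧ ∀ᶠ x in 𝓝 p, h x * eval x f = F x := by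
  classical
  obtain ⟨b, hb⟩ : ∃ b, eval b f ≠ 0 := by
    by_contra! H
    exact hf0 (MvPolynomial.funext fun x => by simpa using H x)
  set e := b - p with he
  have hanf : ∀ x : τ → ℂ, AnalyticAt ℂ (fun x : τ → ℂ => eval x f) x := fun x =>
    AnalyticOnNhd.eval_mvPolynomial f x (Set.mem_univ _)
  obtain ⟨ρ, hρ, hball⟩ := Metric.eventually_nhds_iff_ball.1 (hF.eventually_analyticAt.and (hz.and hs))
  obtain ⟨r, ⟨hr0, hrρ⟩, hrT⟩ : ∃ r, r ∈ Set.Ioo 0 (ρ / 2 / (‖e‖ + 1)) ∧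
      r ∉ norm '' {t : ℂ | eval (p + t • e) f = 0} :=
    ((Set.Ioo_infinite (by positivity)).sdiff ((finite_zeros_slice (t₀ := 1)
      (by simpa [he] using hb)).image _)).nonempty
  have hre : r * ‖e‖ < ρ / 2 := by
    rw [lt_div_iff₀ (by positivity)] at hrρ
    nlinarith
  have hcf : Continuous fun x : τ → ℂ => eval x f := MvPolynomial.continuous_eval f
  have hev : ∀ᶠ z in 𝓝 p, ∀ t ∈ sphere (0 : ℂ) r, eval (z + t • e) f ≠ 0 := by
    refine (isCompact_sphere _ _).eventually_forall_of_forall_eventually fun t ht => ?_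
    have hc : Continuous fun w : (τ → ℂ) × ℂ => eval (w.1 + w.2 • e) f :=
      hcf.comp (by fun_prop)
    exact hc.continuousAt.eventually_ne fun h0 => hrT ⟨t, h0, mem_sphere_zero_iff_norm.1 ht⟩
  obtain ⟨δ', hδ', hballδ'⟩ := Metric.eventually_nhds_iff_ball.1 hev
  set δ := min δ' (ρ / 2) with hδdef
  have hδ : 0 < δ := by positivity
  have hmem : ∀ z ∈ ball p δ, ∀ t ∈ closedBall (0 : ℂ) r, z + t • e ∈ ball p ρ := by
    intro z hz t ht
    have h1 : dist z p < ρ / 2 := (mem_ball.1 hz).trans_le (min_le_right _ _)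
    have h2 : ‖t • e‖ ≤ r * ‖e‖ := by
      rw [norm_smul]
      exact mul_le_mul_of_nonneg_right (mem_closedBall_zero_iff.1 ht) (norm_nonneg _)
    rw [mem_ball_iff_norm]
    rw [dist_eq_norm] at h1
    calc ‖z + t • e - p‖ = ‖(z - p) + t • e‖ := by congr 1; abel
      _ ≤ ‖z - p‖ + ‖t • e‖ := norm_add_le _ _
      _ < ρ := by linarith
  set Ω : Set (τ → ℂ) := ball p ρ ∩ {x | eval x f ≠ 0} with hΩdef
  have hΩ : IsOpen Ω := isOpen_ball.inter (isOpen_ne.preimage hcf)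
  have hΩmem : ∀ z ∈ ball p δ, ∀ t ∈ sphere (0 : ℂ) |r|, z + t • e ∈ Ω := by
    intro z hz t ht
    rw [abs_of_pos hr0] at ht
    exact ⟨hmem z hz t (sphere_subset_closedBall ht),
      hballδ' z (ball_subset_ball (min_le_left _ _) hz) t ht⟩
  set Q : (τ → ℂ) → ℂ := fun x => F x / eval x f with hQdef
  have hQ : AnalyticOnNhd ℂ Q Ω := fun x hx => (hball x hx.1).1.div (hanf x) hx.2
  have hder : ∀ Φ, AnalyticOnNhd ℂ Φ Ω → ∀ z ∈ ball p δ, HasFDerivAt _ _ z :=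
    fun Φ hΦ z hz => hasFDerivAt_circleAverage hΩ hΦ (hΩmem z hz)
  refine ⟨fun z => Real.circleAverage (fun t => Q (z + t • e)) 0 r, fun K => ?_, ?_⟩
  · refine exists_isJet_of_class (F := {h | ∃ Φ, AnalyticOnNhd ℂ Φ Ω ∧
      h = fun z => Real.circleAverage (fun t => Φ (z + t • e)) 0 r}) ?_ ?_ K ⟨Q, hQ, rfl⟩
    · rintro _ ⟨Φ, hΦ, rfl⟩
      exact (hder Φ hΦ p (mem_ball_self hδ)).continuousAt.isBigO_one ℝ
    · rintro _ ⟨Φ, hΦ, rfl⟩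
      refine ⟨fun j z => Real.circleAverage (fun t => fderiv ℂ Φ (z + t • e) (Pi.single j 1)) 0 r,
        fun j => ⟨fun x => fderiv ℂ Φ x (Pi.single j 1), fun x hx => ?_, rfl⟩, ?_⟩
      · exact ((ContinuousLinearMap.apply ℂ ℂ (Pi.single j 1)).analyticAt _).comp (hΦ x hx).fderiv
      · filter_upwards [ball_mem_nhds p hδ] with z hz using hder Φ hΦ z hz
  · have hkey : Set.EqOn (fun z => Real.circleAverage (fun t => Q (z + t • e)) 0 r * eval z f) F
        (ball p δ ∩ ((Submodule.span ℂ {p, e} : Submodule ℂ (τ → ℂ)) : Set (τ → ℂ))ᶜ) := by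
      rintro z ⟨hzδ, hzspan⟩
      have h0mem : (0 : ℂ) ∈ closedBall (0 : ℂ) r := mem_closedBall_self hr0.le
      have hzρ : z ∈ ball p ρ := by simpa using hmem z hzδ 0 h0mem
      dsimp only
      by_cases hfz : eval z f = 0
      · rw [hfz, mul_zero, (hball z hzρ).2.1 hfz]
      have hlc : Continuous fun t : ℂ => z + t • e := by fun_prop
      rw [circleAverage_eq_of_removable (G := fun t => Q (z + t • e)) hr0
        (S := {t : ℂ | eval (z + t • e) f = 0}) (finite_zeros_slice (t₀ := 0) (by simpa using hfz))]
      · simp only [zero_smul, add_zero, hQdef]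
        exact div_mul_cancel₀ _ hfz
      · intro t ht htS
        have hxΩ : z + t • e ∈ Ω := ⟨hmem z hzδ t ht, htS⟩
        filter_upwards [hlc.continuousAt (hΩ.mem_nhds hxΩ)] with s hs
        exact (hQ _ hs).differentiableAt.comp (f := fun t : ℂ => z + t • e) s (by fun_prop)
      · intro t ht htS
        have htS : eval (z + t • e) f = 0 := htS
        have hx := hmem z hzδ t ht
        have hne : evalFDeriv f (z + t • e) ≠ 0 := by
          intro h0
          obtain ⟨c, hc⟩ := (hball _ hx).2.2 htS fun i => by
            have := congrArg (fun L : (τ → ℂ) →L[ℂ] ℂ => L (Pi.single i 1)) h0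
            simpa [evalFDeriv_apply, Pi.single_apply] using this
          refine hzspan ?_
          have hz' : z = c • p - t • e := by rw [← hc]; abel
          rw [hz']
          exact sub_mem (Submodule.smul_mem _ _ (Submodule.subset_span (by simp)))
            (Submodule.smul_mem _ _ (Submodule.subset_span (by simp)))
        have h1 := (hasStrictFDerivAt_eval f (z + t • e)).isBigO_of_zeros hne htS
          (hball _ hx).1.hasStrictFDerivAt
          (by filter_upwards [isOpen_ball.mem_nhds hx] with y hy using (hball y hy).2.1)
        obtain ⟨C, hC0, hC⟩ := (h1.comp_tendsto hlc.continuousAt).exists_nonneg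
        refine IsBigO.of_bound C ?_
        filter_upwards [nhdsWithin_le_nhds hC.bound] with s hs
        simp only [Function.comp] at hs
        simp only [hQdef, norm_div, norm_one, mul_one]
        exact div_le_of_le_mul₀ (norm_nonneg _) hC0 hs
      · intro t ht htr
        exact hballδ' z (ball_subset_ball (min_le_left _ _) hzδ) t
          (mem_sphere_zero_iff_norm.2 htr) ht
      · simpa using hfz
    have hall := hkey.of_subset_closure (t := ball p δ)
      (fun z hz => ((hder Q hQ z hz).continuousAt.mul hcf.continuousAt).continuousWithinAt)
      (fun z hz => (hball z (ball_subset_ball ((min_le_right _ _).trans (by linarith)) hz)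
        ).1.continuousAt.continuousWithinAt) Set.inter_subset_left
      ((dense_compl_span_pair hcard p e).open_subset_closure_inter isOpen_ball)
    filter_upwards [ball_mem_nhds p hδ] with z hz using hall hz

end Division

section WeightedHomogeneous

open Filter Topology Asymptotics

lemma IsWeightedHomogeneousPoly.exists_nat_weights {m : ℕ} {g : MvPolynomial (Fin m) ℂ}
    {w : Fin m → ℚ} (hg : IsWeightedHomogeneousPoly g w) :
    ∃ (D : ℕ) (W : Fin m → ℕ), (∀ i, 0 < W i) ∧
      ∀ (c : ℂ) (x : Fin m → ℂ), eval (fun j => c ^ W j * x j) g = c ^ D * eval x g := by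
  obtain ⟨hw, hg⟩ := hg
  set D : ℕ := ∏ i, (w i).den with hD
  have hDpos : 0 < D := Finset.prod_pos fun i _ => (w i).pos
  have hW : ∀ i, ∃ k : ℕ, 0 < k ∧ (k : ℚ) = w i * D := by
    intro i
    have hnum : 0 < (w i).num := Rat.num_pos.2 (hw i)
    refine ⟨(w i).num.toNat * ∏ j ∈ Finset.univ.erase i, (w j).den,
      Nat.mul_pos (by omega) (Finset.prod_pos fun j _ => (w j).pos), ?_⟩
    rw [hD, ← Finset.mul_prod_erase _ _ (Finset.mem_univ i)]
    push_cast
    rw [← mul_assoc, Rat.mul_den_eq_num]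
    congr 1
    exact_mod_cast Int.toNat_of_nonneg hnum.le
  choose W hWpos hWD using hW
  refine ⟨D, W, hWpos, fun c x => ?_⟩
  rw [eval_eq', eval_eq', Finset.mul_sum]
  refine Finset.sum_congr rfl fun α hα => ?_
  have h1 : ∑ i, W i * α i = D := by
    have : (∑ i, (W i : ℚ) * α i) = D := by
      simp only [hWD]
      have := hg α hα
      calc ∑ i, w i * D * (α i : ℚ) = D * ∑ i, w i * (α i : ℚ) := by
            rw [Finset.mul_sum]; exact Finset.sum_congr rfl fun _ _ => by ring
        _ = D := by rw [this, mul_one]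
    exact_mod_cast this
  simp only [mul_pow, ← pow_mul, Finset.prod_mul_distrib, Finset.prod_pow_eq_pow_sum, h1]
  ring

lemma IsJet.eval_eq {τ : Type*} [Fintype τ] {K : ℕ} {p : τ → ℂ} {h : (τ → ℂ) → ℂ}
    {P : MvPolynomial τ ℂ} (hP : IsJet (K + 1) p h P) : eval p P = h p := by
  obtain ⟨C, hC⟩ := hP.bound
  have := hC.self_of_nhds
  simp only [sub_self, norm_zero, ne_eq, Nat.succ_ne_zero, not_false_eq_true, zero_pow,
    mul_zero, norm_le_zero_iff] at this
  exact (sub_eq_zero.1 this).symm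

lemma IsJet.continuousAt {τ : Type*} [Fintype τ] {K : ℕ} {p : τ → ℂ} {h : (τ → ℂ) → ℂ}
    {P : MvPolynomial τ ℂ} (hP : IsJet (K + 1) p h P) : ContinuousAt h p := by
  have h1 : Tendsto (fun x : τ → ℂ => ‖x - p‖ ^ (K + 1)) (𝓝 p) (𝓝 0) := by
    have : Continuous fun x : τ → ℂ => ‖x - p‖ ^ (K + 1) := by fun_prop
    simpa using this.tendsto p
  have h2 := (hP.trans_tendsto h1).add ((MvPolynomial.continuous_eval P).tendsto p)
  simpa [ContinuousAt, ← hP.eval_eq] using h2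

/-- The logarithmic derivative of an analytic function at a zero of finite order. -/
lemma ne_zero_of_tendsto_logDeriv {u v : ℂ → ℂ} {c : ℂ} (hu : AnalyticAt ℂ u 0) (hu0 : u 0 = 0)
    (hne : ∀ᶠ s in 𝓝[≠] 0, u s ≠ 0) (huv : ∀ᶠ s in 𝓝 0, s * deriv u s = v s * u s)
    (hv : Tendsto v (𝓝 0) (𝓝 c)) : c ≠ 0 := by
  obtain ⟨k, w, hw, hw0, hkw⟩ := (hu.exists_eventuallyEq_pow_smul_nonzero_iff).2 (by
    intro h
    obtain ⟨s, h1, h2⟩ := (hne.and (nhdsWithin_le_nhds h)).exists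
    exact h1 h2)
  simp only [sub_zero, smul_eq_mul] at hkw
  have hk : k ≠ 0 := by
    rintro rfl
    have := hkw.self_of_nhds
    simp [hu0] at this
    exact hw0 this.symm
  have h1 : ∀ᶠ s in 𝓝[≠] (0 : ℂ), v s = k + s * deriv w s / w s := by
    have hd : ∀ᶠ s in 𝓝 (0 : ℂ), deriv u s = k * s ^ (k - 1) * w s + s ^ k * deriv w s := by
      filter_upwards [hkw.eventually_nhds, hw.eventually_analyticAt] with s hs hws
      rw [EventuallyEq.deriv_eq hs]
      exact ((hasDerivAt_pow k s).mul hws.differentiableAt.hasDerivAt).deriv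
    filter_upwards [nhdsWithin_le_nhds hd, nhdsWithin_le_nhds huv, nhdsWithin_le_nhds hkw,
      self_mem_nhdsWithin, nhdsWithin_le_nhds (hw.continuousAt.eventually_ne hw0)]
      with s h1 h2 h3 h4 h5
    have h4 : s ≠ 0 := h4
    rw [h1, h3] at h2
    have h6 : s ^ k ≠ 0 := pow_ne_zero _ h4
    have h7 : s * s ^ (k - 1) = s ^ k := by
      rw [← pow_succ']; congr 1; omega
    have h8 : s ^ k * (v s * w s) = s ^ k * (k * w s + s * deriv w s) := by
      rw [← h7] at h2 ⊢
      linear_combination -h2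
    have h9 := mul_left_cancel₀ h6 h8
    field_simp
    linear_combination h9
  have h2 : Tendsto (fun s => (k : ℂ) + s * deriv w s / w s) (𝓝[≠] 0) (𝓝 (k + 0 * deriv w 0 / w 0)) :=
    (tendsto_const_nhds.add (((tendsto_id.mul hw.deriv.continuousAt).div hw.continuousAt hw0))).mono_left
      nhdsWithin_le_nhds
  have h3 := tendsto_nhds_unique (h2.congr' (by filter_upwards [h1] with s hs using hs.symm))
    (hv.mono_left nhdsWithin_le_nhds)
  rw [zero_mul, zero_div, add_zero] at h3
  rw [← h3]
  exact_mod_cast hk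

lemma hasDerivAt_eval_insertNth (f : MvPolynomial (Fin (n + 1)) ℂ) (i : Fin (n + 1)) (a : ℂ)
    {y : ℂ → Fin n → ℂ} {y' : Fin n → ℂ} {s : ℂ} (hy : HasDerivAt y y' s) :
    HasDerivAt (fun s => eval (a • (i.insertNth 1 (y s) : Fin (n + 1) → ℂ)) f)
      (∑ j, a * y' j * eval (a • (i.insertNth 1 (y s) : Fin (n + 1) → ℂ))
        (pderiv (i.succAbove j) f)) s := by
  have h1 : HasDerivAt (fun s => a • (i.insertNth 1 (y s) : Fin (n + 1) → ℂ))
      (a • (i.insertNth 0 y' : Fin (n + 1) → ℂ)) s := by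
    refine HasDerivAt.fun_const_smul a ?_
    rw [hasDerivAt_pi, Fin.forall_iff_succAbove i]
    refine ⟨by simpa using hasDerivAt_const s (1 : ℂ), fun j => ?_⟩
    simpa using (hasDerivAt_pi.1 hy) j
  refine ((hasFDerivAt_eval f _).comp_hasDerivAt s h1).congr_deriv ?_
  rw [evalFDeriv_apply, Fin.sum_univ_succAbove _ i]
  simp [mul_comm]

end WeightedHomogeneous

section LocalRelation

open Filter Topology Asymptotics

lemma eq_zero_of_eventually_eval_eq_zero {τ : Type*} [Fintype τ] {f : MvPolynomial τ ℂ}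
    {p : τ → ℂ} (h : ∀ᶠ x in 𝓝 p, eval x f = 0) : f = 0 := by
  by_contra hf0
  obtain ⟨b, hb⟩ : ∃ b, eval b f ≠ 0 := by
    by_contra! H
    exact hf0 (MvPolynomial.funext fun x => by simpa using H x)
  have hfin := finite_zeros_slice (f := f) (c := p) (e := b - p) (t₀ := 1) (by simpa using hb)
  have hc : Continuous fun t : ℂ => p + t • (b - p) := by fun_prop
  have h' : ∀ᶠ x in 𝓝 (p + (0 : ℂ) • (b - p)), eval x f = 0 := by simpa using h
  have h1 : ∀ᶠ t : ℂ in 𝓝 0, eval (p + t • (b - p)) f = 0 := (hc.tendsto 0).eventually h'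
  exact infinite_of_mem_nhds (0 : ℂ) h1 hfin

lemma eval_dehom (f : MvPolynomial (Fin (n + 1)) ℂ) (i : Fin (n + 1)) (y : Fin n → ℂ) :
    eval y (dehom f i) = eval (i.insertNth 1 y : Fin (n + 1) → ℂ) f := by
  rw [dehom, eval_aeval]
  congr 2
  ext k
  refine Fin.succAboveCases i ?_ (fun j => ?_) k <;> simp

/-- At a weighted homogeneous singular point the Euler vector field of the singularity lifts to
a relation between the partial derivatives, with coefficients proportional to the point. -/
theorem exists_local_relation (hn : 2 ≤ n) {d : ℕ} {f : MvPolynomial (Fin (n + 1)) ℂ}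
    (hf : f.IsHomogeneous d) (hf0 : f ≠ 0) {i : Fin (n + 1)} {y₀ : Fin n → ℂ}
    (hwh : HasWeightedHomogeneousSingularityAt {y : Fin n → ℂ | eval y (dehom f i) = 0} y₀)
    {p : Fin (n + 1) → ℂ} (hp : p = i.insertNth 1 y₀) (hfp : eval p f = 0)
    (hs : ∀ᶠ x in 𝓝 p, eval x f = 0 → (∀ j, eval x (pderiv j f) = 0) → ∃ c : ℂ, x = c • p) :
    ∃ ξ : Fin (n + 1) → (Fin (n + 1) → ℂ) → ℂ, (∀ j K, ∃ P, IsJet K p (ξ j) P) ∧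
      (∀ᶠ x in 𝓝 p, ∑ j, ξ j x * eval x (pderiv j f) = 0) ∧
      ∃ c : ℂ, c ≠ 0 ∧ ∀ j, ξ j p = c * p j := by
  obtain ⟨g, w, hg, U, V, φ, ψ, hU, hV, hy₀, h0V, hφ, hψ, hφV, hψU, hψφ, hφψ, hφ0, hS⟩ := hwh
  obtain ⟨D, W, hWpos, hgW⟩ := hg.exists_nat_weights
  simp only [Set.mem_ofPred_eq, eval_dehom] at hS
  have hpi : p i = 1 := by rw [hp]; simp
  have hpj : ∀ j, p (i.succAbove j) = y₀ j := fun j => by rw [hp]; simp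
  let yc : (Fin (n + 1) → ℂ) → Fin n → ℂ := fun x j => x (i.succAbove j) / x i
  have hyc : ∀ (a : ℂ) (y : Fin n → ℂ), a ≠ 0 → yc (a • (i.insertNth 1 y : Fin (n + 1) → ℂ)) = y := by
    intro a y ha
    ext j
    simp [yc, ha]
  have hchart : ∀ x : Fin (n + 1) → ℂ, x i ≠ 0 →
      x i • (i.insertNth 1 (yc x) : Fin (n + 1) → ℂ) = x := by
    intro x hx
    ext k
    refine Fin.succAboveCases i ?_ (fun j => ?_) k
    · simp
    · simp [yc, mul_div_cancel₀ _ hx]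
  have hycp : yc p = y₀ := by ext j; simp [yc, hpi, hpj]
  have hproj : ∀ j : Fin (n + 1), AnalyticAt ℂ (fun x : Fin (n + 1) → ℂ => x j) p := fun j =>
    (ContinuousLinearMap.proj (R := ℂ) (φ := fun _ : Fin (n + 1) => ℂ) j).analyticAt p
  have hycan : AnalyticAt ℂ yc p := by
    rw [analyticAt_pi_iff]
    exact fun j => (hproj _).div (hproj i) (by simp [hpi])
  let sc : ℂ → (Fin n → ℂ) → Fin n → ℂ := fun s ζ j => s ^ W j * ζ j
  have hsc : ∀ ζ, Continuous fun s => sc s ζ := by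
    intro ζ
    fun_prop
  have hsc0 : ∀ ζ, sc 0 ζ = 0 := by
    intro ζ; ext j; simp [sc, (hWpos j).ne']
  have hsc1 : ∀ ζ, sc 1 ζ = ζ := by
    intro ζ; ext j; simp [sc]
  let A : (Fin n → ℂ) →L[ℂ] (Fin n → ℂ) := ContinuousLinearMap.pi fun j => (W j : ℂ) •
    ContinuousLinearMap.proj j
  let E : (Fin n → ℂ) → Fin n → ℂ := fun y => fderiv ℂ ψ (φ y) (A (φ y))
  have hEan : AnalyticAt ℂ E y₀ := by
    have h1 : AnalyticAt ℂ φ y₀ := hφ _ hy₀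
    have h2 : AnalyticAt ℂ (fun y => fderiv ℂ ψ (φ y)) y₀ :=
      AnalyticAt.fun_comp (f := φ) (g := fderiv ℂ ψ) (by rw [hφ0]; exact (hψ 0 h0V).fderiv) h1
    have h3 : AnalyticAt ℂ (fun y => A (φ y)) y₀ := (A.analyticAt _).comp h1
    exact AnalyticAt.comp₂ (h := fun T : ((Fin n → ℂ) →L[ℂ] Fin n → ℂ) × (Fin n → ℂ) => T.1 T.2)
      ((ContinuousLinearMap.id ℂ ((Fin n → ℂ) →L[ℂ] Fin n → ℂ)).analyticAt_bilinear _) h2 h3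
  have hE0 : E y₀ = 0 := by simp [E, hφ0]
  have hEc : ∀ j, AnalyticAt ℂ (fun x => E (yc x) j) p := by
    intro j
    have h1 : AnalyticAt ℂ (fun x => E (yc x)) p :=
      AnalyticAt.fun_comp (f := yc) (g := E) (by rwa [hycp]) hycan
    exact (analyticAt_pi_iff.1 h1) j
  have hpol : ∀ P : MvPolynomial (Fin (n + 1)) ℂ,
      AnalyticAt ℂ (fun x : Fin (n + 1) → ℂ => eval x P) p := fun P =>
    AnalyticOnNhd.eval_mvPolynomial P p (Set.mem_univ _)
  let F : (Fin (n + 1) → ℂ) → ℂ := fun x =>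
    ∑ j, x i * E (yc x) j * eval x (pderiv (i.succAbove j) f)
  have hFan : AnalyticAt ℂ F p :=
    Finset.analyticAt_fun_sum _ fun j _ => ((hproj i).mul (hEc j)).mul (hpol _)
  have hcurve : ∀ (a : ℂ) (ζ : Fin n → ℂ) (s : ℂ), a ≠ 0 → sc s ζ ∈ V → ∃ u' : ℂ,
      HasDerivAt (fun s => eval (a • (i.insertNth 1 (ψ (sc s ζ)) : Fin (n + 1) → ℂ)) f) u' s ∧
      s * u' = F (a • (i.insertNth 1 (ψ (sc s ζ)) : Fin (n + 1) → ℂ)) := by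
    intro a ζ s ha hsV
    have h1 : HasDerivAt (fun s => sc s ζ) (fun j => W j * s ^ (W j - 1) * ζ j) s := by
      rw [hasDerivAt_pi]
      exact fun j => (hasDerivAt_pow (W j) s).mul_const (ζ j)
    have h2 := ((hψ _ hsV).differentiableAt.hasFDerivAt).comp_hasDerivAt s h1
    refine ⟨_, hasDerivAt_eval_insertNth f i a h2, ?_⟩
    have h3 : A (sc s ζ) = s • fun j => W j * s ^ (W j - 1) * ζ j := by
      ext j
      have : s * s ^ (W j - 1) = s ^ W j := by
        rw [← pow_succ']; congr 1; have := hWpos j; omega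
      simp only [A, sc, ContinuousLinearMap.pi_apply, smul_apply,
        ContinuousLinearMap.proj_apply, smul_eq_mul, Pi.smul_apply]
      rw [← this]; ring
    simp only [F, E, hyc _ _ ha, hφψ _ hsV, h3, map_smul, Finset.mul_sum]
    refine Finset.sum_congr rfl fun j _ => ?_
    simp only [Pi.smul_apply, smul_eq_mul, Fin.insertNth_apply_same]
    ring
  have hnear : ∀ᶠ x in 𝓝 p, x i ≠ 0 ∧ yc x ∈ U :=
    ((hproj i).continuousAt.eventually_ne (by simp [hpi])).and
      (hycan.continuousAt (hU.mem_nhds (by rwa [hycp])))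
  have hzero : ∀ x : Fin (n + 1) → ℂ, x i ≠ 0 → yc x ∈ U →
      (eval x f = 0 ↔ eval (φ (yc x)) g = 0) := by
    intro x hx hxU
    rw [← hS _ hxU]
    conv_lhs => rw [← hchart x hx, eval_smul_of_isHomogeneous hf]
    simp [hx]
  have hFz : ∀ᶠ x in 𝓝 p, eval x f = 0 → F x = 0 := by
    filter_upwards [hnear] with x hx hfx
    obtain ⟨hxi, hxU⟩ := hx
    set ζ := φ (yc x) with hζ
    obtain ⟨u', h1, h2⟩ := hcurve (x i) ζ 1 hxi (by rw [hsc1]; exact hφV hxU)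
    rw [hsc1, hζ, hψφ _ hxU, hchart x hxi, one_mul] at h2
    rw [← h2]
    have hg0 := (hzero x hxi hxU).1 hfx
    have hev : ∀ᶠ s in 𝓝 (1 : ℂ), sc s ζ ∈ V :=
      (hsc ζ).continuousAt (hV.mem_nhds (by rw [hsc1]; exact hφV hxU))
    refine h1.unique ((hasDerivAt_const (1 : ℂ) (0 : ℂ)).congr_of_eventuallyEq ?_)
    filter_upwards [hev] with s hsV
    rw [eval_smul_of_isHomogeneous hf, (hS _ (hψU hsV)).2, mul_zero]
    rw [hφψ _ hsV]
    change eval (fun j => s ^ W j * ζ j) g = 0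
    rw [hgW, hg0, mul_zero]
  obtain ⟨h, hjet, hh⟩ := exists_quotient_isJet (by rw [Fintype.card_fin]; omega) hf0 hFan hFz hs
  have hhp : h p ≠ 0 := by
    obtain ⟨ζ, hζ⟩ : ∃ ζ, eval ζ g ≠ 0 := by
      by_contra! H
      refine hf0 (eq_zero_of_eventually_eval_eq_zero (p := p) ?_)
      filter_upwards [hnear] with x hx
      exact (hzero x hx.1 hx.2).2 (H _)
    set x : ℂ → Fin (n + 1) → ℂ := fun s => (1 : ℂ) • (i.insertNth 1 (ψ (sc s ζ)) : Fin (n + 1) → ℂ)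
      with hx
    have hψ0 : ψ 0 = y₀ := by rw [← hφ0, hψφ _ hy₀]
    have hx0 : x 0 = p := by rw [hx]; simp only [hsc0, hψ0, one_smul, hp]
    have hev : ∀ᶠ s in 𝓝 (0 : ℂ), sc s ζ ∈ V :=
      (hsc ζ).continuousAt (hV.mem_nhds (by rwa [hsc0]))
    have hxc : ContinuousAt x 0 := by
      have h1 : ContinuousAt (fun s => ψ (sc s ζ)) 0 :=
        ContinuousAt.comp' (g := ψ) (by rw [hsc0]; exact (hψ 0 h0V).continuousAt)
          (hsc ζ).continuousAt
      simp only [hx, one_smul]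
      rw [continuousAt_pi, Fin.forall_iff_succAbove i]
      exact ⟨by simpa using continuousAt_const, fun j => by simpa using (continuousAt_pi.1 h1) j⟩
    obtain ⟨P, hP⟩ := hjet 1
    have hhc : ContinuousAt h p := IsJet.continuousAt (K := 0) hP
    refine ne_zero_of_tendsto_logDeriv (u := fun s => eval (x s) f) (v := fun s => h (x s)) ?_
      (by rw [hx0, hfp]) ?_ ?_ ?_
    · rw [Complex.analyticAt_iff_eventually_differentiableAt]
      filter_upwards [hev] with s hs
      obtain ⟨u', h1, -⟩ := hcurve 1 ζ s one_ne_zero hs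
      exact h1.differentiableAt
    · filter_upwards [nhdsWithin_le_nhds hev, self_mem_nhdsWithin] with s hs hs0 h0
      have hs0 : s ≠ 0 := hs0
      simp only [hx, one_smul] at h0
      have h1 := (hS _ (hψU hs)).1 h0
      rw [hφψ _ hs] at h1
      change eval (fun j => s ^ W j * ζ j) g = 0 at h1
      rw [hgW] at h1
      exact mul_ne_zero (pow_ne_zero _ hs0) hζ h1
    · filter_upwards [hev, hxc.eventually (by rw [hx0]; exact hh)] with s hs hhs
      obtain ⟨u', h1, h2⟩ := hcurve 1 ζ s one_ne_zero hs
      rw [h1.deriv, h2, hhs]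
    · have := hhc.tendsto
      rw [← hx0] at this
      rw [← hx0]
      exact this.comp hxc
  refine ⟨fun m => i.insertNth (α := fun _ => (Fin (n + 1) → ℂ) → ℂ) (fun x => h x * x i)
    (fun j x => h x * x (i.succAbove j) + -(d * (x i * E (yc x) j))) m, ?_, ?_, h p, hhp, ?_⟩
  · have hX : ∀ m K, ∃ P, IsJet K p (fun x => h x * x m) P := by
      intro m K
      obtain ⟨P, hP⟩ := hjet K
      exact ⟨P * X m, by simpa using hP.mul (isJet_eval K p (X m))⟩
    rw [Fin.forall_iff_succAbove i]
    refine ⟨fun K => by simpa using hX i K, fun j K => ?_⟩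
    obtain ⟨P, hP⟩ := hX (i.succAbove j) K
    obtain ⟨Q, hQ⟩ := AnalyticAt.exists_isJet
      (analyticAt_const.mul ((hproj i).mul (hEc j)) : AnalyticAt ℂ (fun x => (d : ℂ) * _) p).neg K
    exact ⟨P + Q, by simpa using hP.add hQ⟩
  · filter_upwards [hh] with x hx
    have heuler := congrArg (eval x) hf.sum_X_mul_pderiv
    simp only [map_sum, map_mul, eval_X, nsmul_eq_mul, map_natCast] at heuler
    rw [Fin.sum_univ_succAbove _ i] at heuler ⊢
    simp only [Fin.insertNth_apply_same, Fin.insertNth_apply_succAbove, add_mul,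
      Finset.sum_add_distrib]
    have h1 : ∑ j, -(d * (x i * E (yc x) j)) * eval x (pderiv (i.succAbove j) f) = -(d * F x) := by
      simp only [F, Finset.mul_sum, ← Finset.sum_neg_distrib]
      exact Finset.sum_congr rfl fun j _ => by ring
    have h2 : ∑ j, h x * x (i.succAbove j) * eval x (pderiv (i.succAbove j) f) =
        h x * ∑ j, x (i.succAbove j) * eval x (pderiv (i.succAbove j) f) := by
      rw [Finset.mul_sum]
      exact Finset.sum_congr rfl fun j _ => by ring
    rw [h1, h2, ← hx]
    linear_combination h x * heuler
  · rw [Fin.forall_iff_succAbove i]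
    refine ⟨by simp, fun j => ?_⟩
    simp [hycp, hE0]

end LocalRelation

section Assembly

open Filter Topology

lemma eventually_exists_eq_smul {τ : Type*} [Fintype τ] {S : Set (τ → ℂ)} (hS : S.Finite)
    {p : τ → ℂ} (hp : p ≠ 0) {Q : (τ → ℂ) → Prop}
    (hQ : ∀ x, Q x → ∃ b ∈ S, ∃ c : ℂ, x = c • b) :
    ∀ᶠ x in 𝓝 p, Q x → ∃ c : ℂ, x = c • p := by
  have h : ∀ b ∈ S, ∀ᶠ x in 𝓝 p, x ∈ Submodule.span ℂ {b} → ∃ c : ℂ, x = c • p := by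
    intro b _
    by_cases hb : p ∈ Submodule.span ℂ {b}
    · obtain ⟨a, ha⟩ := Submodule.mem_span_singleton.1 hb
      have ha0 : a ≠ 0 := by
        rintro rfl
        exact hp (by rw [← ha, zero_smul])
      refine Eventually.of_forall fun x hx => ?_
      obtain ⟨c, rfl⟩ := Submodule.mem_span_singleton.1 hx
      exact ⟨c * a⁻¹, by rw [← ha, smul_smul, inv_mul_cancel_right₀ ha0]⟩
    · filter_upwards [(Submodule.closed_of_finiteDimensional _).isOpen_compl.mem_nhds hb]
        with x hx hx'
      exact absurd hx' hx
  filter_upwards [(eventually_all_finite hS).2 h] with x hx hQx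
  obtain ⟨b, hb, c, rfl⟩ := hQ x hQx
  exact hx b hb (Submodule.smul_mem _ _ (Submodule.mem_span_singleton_self b))

/-- The cone over the singular locus of a hypersurface with isolated weighted homogeneous
singularities is a finite union of lines, each spanned by a vector at which the partial
derivatives satisfy an analytic relation with coefficients proportional to the vector. -/
lemma exists_singular_representatives (hn : 2 ≤ n) {d : ℕ} {f : MvPolynomial (Fin (n + 1)) ℂ}
    (hf : f.IsHomogeneous d) (hf0 : f ≠ 0) (hiso : (singularLocus f).Finite)
    (hwh : ∀ a ∈ singularLocus f, ∃ (i : Fin (n + 1)) (y₀ : Fin n → ℂ),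
      affineChart i y₀ = a ∧
        HasWeightedHomogeneousSingularityAt {y : Fin n → ℂ | eval y (dehom f i) = 0} y₀) :
    ∃ S : Set (Fin (n + 1) → ℂ), S.Finite ∧ 0 ∉ S ∧
      (∀ x, x ≠ 0 → eval x f = 0 → (∀ j, eval x (pderiv j f) = 0) →
        ∃ p ∈ S, ∃ c : ℂ, x = c • p) ∧
      ∀ p ∈ S, ∃ ξ : Fin (n + 1) → (Fin (n + 1) → ℂ) → ℂ, (∀ j K, ∃ P, IsJet K p (ξ j) P) ∧
        (∀ᶠ x in 𝓝 p, ∑ j, ξ j x * eval x (pderiv j f) = 0) ∧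
        ∃ c : ℂ, c ≠ 0 ∧ ∀ j, ξ j p = c * p j := by
  choose! i y hiy hw using hwh
  set P : Proj n → Fin (n + 1) → ℂ := fun a => (i a).insertNth 1 (y a) with hP
  have hP0 : ∀ a, P a ≠ 0 := fun a h => by simpa [hP] using congrFun h (i a)
  have hcover : ∀ x, x ≠ 0 → eval x f = 0 → (∀ j, eval x (pderiv j f) = 0) →
      ∃ p ∈ P '' singularLocus f, ∃ c : ℂ, x = c • p := by
    intro x hx hfx hdx
    have hmem : Projectivization.mk ℂ x hx ∈ singularLocus f :=
      ⟨(eval_rep_mk_eq_zero_iff hf hx).2 hfx,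
        fun j => (eval_rep_mk_eq_zero_iff hf.pderiv hx).2 (hdx j)⟩
    refine ⟨_, Set.mem_image_of_mem _ hmem, ?_⟩
    obtain ⟨c, hc⟩ := (Projectivization.mk_eq_mk_iff' ℂ _ _ hx (hP0 _)).1 (hiy _ hmem).symm
    exact ⟨c, hc.symm⟩
  refine ⟨P '' singularLocus f, hiso.image _, ?_, hcover, ?_⟩
  · rintro ⟨a, -, ha⟩
    exact hP0 a ha
  · rintro _ ⟨a, ha, rfl⟩
    refine exists_local_relation hn hf hf0 (hw a ha) rfl ?_ ?_
    · refine (eval_rep_mk_eq_zero_iff hf (hP0 a)).1 ?_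
      have h := ha.1
      rwa [← hiy a ha] at h
    · have h := eventually_exists_eq_smul (hiso.image P) (hP0 a)
        (Q := fun x => x ≠ 0 ∧ eval x f = 0 ∧ ∀ j, eval x (pderiv j f) = 0)
        fun x hx => hcover x hx.1 hx.2.1 hx.2.2
      filter_upwards [h] with x hx hfx hdx
      by_cases hx0 : x = 0
      · exact ⟨0, by rw [hx0, zero_smul]⟩
      · exact hx ⟨hx0, hfx, hdx⟩

/-- A relation between the partial derivatives at `p` makes the derivative `∂ₘ f` belong, locally
at `p`, to the ideal generated by the polynomials `∂ₖ f - tₖ ∂ₘ f`. -/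
lemma exists_mul_pderiv_mem {f : MvPolynomial (Fin (n + 1)) ℂ} {p : Fin (n + 1) → ℂ}
    {ξ : Fin (n + 1) → (Fin (n + 1) → ℂ) → ℂ} (hξ : ∀ j K, ∃ P, IsJet K p (ξ j) P)
    (hrel : ∀ᶠ x in 𝓝 p, ∑ j, ξ j x * eval x (pderiv j f) = 0) (m : Fin (n + 1)) (t : Fin n → ℂ)
    (h0 : ξ m p + ∑ j, t j * ξ (m.succAbove j) p ≠ 0) :
    ∃ u, eval p u ≠ 0 ∧ u * pderiv m f ∈ Ideal.span (Set.range fun j =>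
      pderiv (m.succAbove j) f - C (t j) * pderiv m f) := by
  refine exists_mul_mem_of_jets (ξ := fun j => ξ (m.succAbove j))
    (ξ₀ := fun x => ξ m x + ∑ j, t j * ξ (m.succAbove j) x) (fun j => hξ _) (fun K => ?_) ?_ h0
  · choose P hP using fun j => hξ j K
    refine ⟨P m + ∑ j, C (t j) * P (m.succAbove j), (hP m).add (IsJet.sum fun j _ => ?_)⟩
    simpa using (isJet_eval K p (C (t j))).mul (hP (m.succAbove j))
  · filter_upwards [hrel] with x hx
    rw [Fin.sum_univ_succAbove _ m] at hx
    rw [← hx, add_mul, Finset.sum_mul]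
    simp only [map_sub, map_mul, eval_C, mul_sub, Finset.sum_sub_distrib]
    have : ∑ j, ξ (m.succAbove j) x * (t j * eval x (pderiv m f)) =
        ∑ j, t j * ξ (m.succAbove j) x * eval x (pderiv m f) :=
      Finset.sum_congr rfl fun j _ => by ring
    rw [this]
    ring

lemma pderiv_pderiv_comm {τ : Type*} (i j : τ) (f : MvPolynomial τ ℂ) :
    pderiv i (pderiv j f) = pderiv j (pderiv i f) := by
  classical
  induction f using MvPolynomial.induction_on with
  | C a => simp
  | add p q hp hq => simp only [map_add, hp, hq]
  | mul_X p k hp =>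
    simp only [pderiv_mul, pderiv_X, Pi.single_apply, map_add, hp, apply_ite (pderiv _), map_zero,
      Derivation.map_one_eq_zero, ite_self]
    ring

/-- If the Hessian of `f` at `q` is invertible, then the differentials at `q` of the polynomials
`∂ₖ f - tₖ ∂ₘ f` are linearly independent. -/
lemma eq_zero_of_hessian_combination {f : MvPolynomial (Fin (n + 1)) ℂ} {q : Fin (n + 1) → ℂ}
    (hq : ∀ w, gradFDeriv f q w = 0 → w = 0) (m : Fin (n + 1)) (t w : Fin n → ℂ)
    (hw : ∀ i, ∑ j, w j * eval q
      (pderiv i (pderiv (m.succAbove j) f - C (t j) * pderiv m f)) = 0) : w = 0 := by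
  have h := hq (m.insertNth (-∑ j, w j * t j) w) (by
    ext i
    have h1 := hw i
    simp only [map_sub, pderiv_C_mul, map_mul, eval_C, mul_sub,
      Finset.sum_sub_distrib, ← mul_assoc, ← Finset.sum_mul] at h1
    simp only [gradFDeriv, ContinuousLinearMap.pi_apply, evalFDeriv_apply, Pi.zero_apply]
    rw [Fin.sum_univ_succAbove _ m]
    simp only [Fin.insertNth_apply_same, Fin.insertNth_apply_succAbove, pderiv_pderiv_comm _ i]
    rw [← h1, add_comm, mul_neg, ← sub_eq_add_neg, mul_comm (∑ j, w j * t j)]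
    congr 1
    exact Finset.sum_congr rfl fun j _ => mul_comm _ _)
  ext j
  simpa using congrFun h (m.succAbove j)

end Assembly

/-- Theorem 3(i).  Let `f` be a reduced (squarefree)
homogeneous polynomial of degree `d > 2` in `n + 1 > 3` variables whose
projective hypersurface `V(f)` has only isolated singularities, all weighted
homogeneous (in suitable local analytic coordinates in an affine chart).
Then `d(f) ≠ 1`. -/
theorem conjecture_true_for_weighted_homogeneous
    (n d : ℕ) (f : MvPolynomial (Fin (n + 1)) ℂ)
    (hred : Squarefree f) (hf : f.IsHomogeneous d) (hd : 2 < d) (hn : 2 < n)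
    (hiso : (singularLocus f).Finite)
    (hwh : ∀ a ∈ singularLocus f, ∃ (i : Fin (n + 1)) (y₀ : Fin n → ℂ),
      affineChart i y₀ = a ∧
      HasWeightedHomogeneousSingularityAt
        {y : Fin n → ℂ | eval y (dehom f i) = 0} y₀) :
    ¬ HasGradDegree f 1 := by
  intro hdeg
  have hf0 : f ≠ 0 := hred.ne_zero
  obtain ⟨S, hS, hS0, hcov, hrel⟩ := exists_singular_representatives (by omega) hf hf0 hiso hwh
  obtain ⟨v, q, hv, hq, hfq, hgq, hfib, hinj, hSv⟩ := exists_generic_target hf hd hdeg hS hS0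
  obtain ⟨m, hm⟩ := Function.ne_iff.1 hv
  have hgq' : ∀ k, eval q (pderiv k f) = v k := congrFun hgq
  set t : Fin n → ℂ := fun j => v (m.succAbove j) / v m with ht
  have htm : ∀ j, t j * v m = v (m.succAbove j) := fun j => div_mul_cancel₀ _ hm
  set g : Fin n → MvPolynomial (Fin (n + 1)) ℂ := fun j =>
    pderiv (m.succAbove j) f - C (t j) * pderiv m f with hg
  have hgq0 : ∀ j, eval q (g j) = 0 := fun j => by simp [hg, hgq', htm]
  have hmem : pderiv m f ∈ Ideal.span (Set.range g) := by
    refine mem_span_of_local (e := d - 1) (q := q) (S := insert q S) hn (by omega) (fun j => ?_)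
      hf.pderiv hq hgq0 (eq_zero_of_hessian_combination hinj m t) (hS.insert q) ?_ ?_ ?_
    · exact hf.pderiv.sub (by simpa using (isHomogeneous_C _ (t j)).mul (hf.pderiv (i := m)))
    · simpa [hq.symm] using hS0
    · intro x hx
      have hx' : gradMap f x = (eval x (pderiv m f) / v m) • v := by
        ext k
        refine Fin.succAboveCases m ?_ (fun j => ?_) k
        · simp only [gradMap, Pi.smul_apply, smul_eq_mul]
          exact (div_mul_cancel₀ _ hm).symm
        · have h := hx j
          simp only [hg, map_sub, map_mul, eval_C, sub_eq_zero] at h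
          simp only [gradMap, Pi.smul_apply, smul_eq_mul, h, ht]
          ring
      by_cases h0 : eval x (pderiv m f) / v m = 0
      · rw [h0, zero_smul] at hx'
        have hdx : ∀ j, eval x (pderiv j f) = 0 := congrFun hx'
        have hfx := congrArg (eval x) hf.sum_X_mul_pderiv
        simp only [map_sum, map_mul, hdx, mul_zero, Finset.sum_const_zero, nsmul_eq_mul,
          map_natCast] at hfx
        have hfx := (mul_eq_zero.1 hfx.symm).resolve_left (Nat.cast_ne_zero.2 (by omega))
        by_cases hx0 : x = 0
        · exact ⟨q, Set.mem_insert _ _, 0, by rw [hx0, zero_smul]⟩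
        · obtain ⟨p, hp, c, hc⟩ := hcov x hx0 hfx hdx
          exact ⟨p, Set.mem_insert_of_mem _ hp, c, hc⟩
      · obtain ⟨b, hb⟩ := hfib x _ h0 hx'
        exact ⟨q, Set.mem_insert _ _, b, hb⟩
    · rintro p (rfl | hp)
      · exact Or.inl rfl
      · obtain ⟨ξ, hξ, hrelp, c, hc, hcp⟩ := hrel p hp
        refine Or.inr (exists_mul_pderiv_mem hξ hrelp m t fun h => ?_)
        refine mul_ne_zero hc (hSv p hp) ?_
        rw [Fin.sum_univ_succAbove _ m, mul_add, Finset.mul_sum]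
        simp only [hcp] at h
        have h := congrArg (· * v m) h
        simp only [add_mul, Finset.sum_mul, zero_mul] at h
        rw [← h]
        congr 1
        · ring
        · exact Finset.sum_congr rfl fun j _ => by rw [← htm]; ring
  have hle : Ideal.span (Set.range g) ≤ RingHom.ker (eval q) := by
    rw [Ideal.span_le]
    rintro _ ⟨j, rfl⟩
    exact hgq0 j
  exact hm ((hgq' m).symm.trans (hle hmem))

end
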